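/- arXiv:1702.02648 — 2 statements merged into one kernel-verified Lean document; each statement's English description precedes it below -/
import Mathlib

section
/- Let ε > 0 and Δ ≥ 2 be fixed, and let (H_n) be a sequence of graphs with maximum degree Δ(H_n) ≤ Δ and v(H_n) ≤ (1−ε)n. If p = p(n) satisfies p·n^{2/(Δ+1)}/(log n)^{2/((Δ+1)Δ)} → ∞ (that is, p times n^{2/(Δ+1)} divided by (log n)^{1/binom(Δ+1,2)} tends to infinity), then a.a.s. G(n,p) contains a copy of H_n. -/
open MeasureTheory Filter Topology

/-- Bernoulli measure on `Bool` with success probability `p` (clamped to `[0,1]`). -/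
noncomputable def bernoulliMeasure (p : ℝ) : Measure Bool :=
  (min (ENNReal.ofReal p) 1) • Measure.dirac true +
    (1 - min (ENNReal.ofReal p) 1) • Measure.dirac false

/-- The distribution of the binomial random graph `G(n,p)`, as a product of independent
Bernoulli measures, one for each potential edge. -/
noncomputable def gnp (n : ℕ) (p : ℝ) : Measure (Sym2 (Fin n) → Bool) :=
  Measure.pi fun _ => bernoulliMeasure p

/-- The simple graph on `[n]` determined by an outcome of the edge indicators. -/
def graphOf {n : ℕ} (ω : Sym2 (Fin n) → Bool) : SimpleGraph (Fin n) :=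
  SimpleGraph.fromRel fun u v => ω s(u, v) = true

/-- `G` contains a (not necessarily induced) copy of `H`. -/
def ContainsCopy {α β : Type*} (H : SimpleGraph α) (G : SimpleGraph β) : Prop :=
  ∃ f : α → β, Function.Injective f ∧ ∀ ⦃u v⦄, H.Adj u v → G.Adj (f u) (f v)

/-- The maximum degree of a graph on a finite vertex type. -/
noncomputable def maxDeg {V : Type*} [Fintype V] (G : SimpleGraph V) : ℕ :=
  Finset.univ.sup fun v => (G.neighborSet v).ncard

/-- The maximum 0-density `m₀(H)`. -/
noncomputable def m0 {V : Type*} [Fintype V] (H : SimpleGraph V) : ℝ :=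
  sSup {x : ℝ | ∃ H' : H.Subgraph, H'.verts.Nonempty ∧
    x = (H'.edgeSet.ncard : ℝ) / (H'.verts.ncard : ℝ)}

/-- The maximum 1-density `m₁(H)`. -/
noncomputable def m1 {V : Type*} [Fintype V] (H : SimpleGraph V) : ℝ :=
  sSup {x : ℝ | ∃ H' : H.Subgraph, 1 < H'.verts.ncard ∧
    x = (H'.edgeSet.ncard : ℝ) / ((H'.verts.ncard : ℝ) - 1)}

/-- The maximum 2-density `m₂(H)`. -/
noncomputable def m2 {V : Type*} [Fintype V] (H : SimpleGraph V) : ℝ :=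
  sSup {x : ℝ | ∃ H' : H.Subgraph, 0 < H'.edgeSet.ncard ∧
    x = if 2 < H'.verts.ncard
      then ((H'.edgeSet.ncard : ℝ) - 1) / ((H'.verts.ncard : ℝ) - 2)
      else 1 / 2}

/-- The maximum Riordan-density `m_R(H)`. -/
noncomputable def mR {V : Type*} [Fintype V] (H : SimpleGraph V) : ℝ :=
  sSup {x : ℝ | ∃ H' : H.Subgraph, 2 < H'.verts.ncard ∧
    x = (H'.edgeSet.ncard : ℝ) / ((H'.verts.ncard : ℝ) - 2)}

/-- The local 1-density `m₁(x,H)` of `H` at the vertex `x`. -/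
noncomputable def m1At {V : Type*} [Fintype V] (H : SimpleGraph V) (x : V) : ℝ :=
  sSup {r : ℝ | ∃ H' : H.Subgraph, x ∈ H'.verts ∧ 1 < H'.verts.ncard ∧
    r = (H'.edgeSet.ncard : ℝ) / ((H'.verts.ncard : ℝ) - 1)}

/-- `H` is strictly 1-balanced: `H` itself is the unique maximiser of the 1-density. -/
def StrictlyOneBalanced {V : Type*} [Fintype V] (H : SimpleGraph V) : Prop :=
  ∀ H' : H.Subgraph, 1 < H'.verts.ncard → H' ≠ ⊤ →
    (H'.edgeSet.ncard : ℝ) / ((H'.verts.ncard : ℝ) - 1) <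
      (H.edgeSet.ncard : ℝ) / ((Fintype.card V : ℝ) - 1)

/-- `H` is vertex-1-balanced: the local 1-density at every vertex equals `m₁(H)`. -/
def VertexOneBalanced {V : Type*} [Fintype V] (H : SimpleGraph V) : Prop :=
  ∀ x : V, m1At H x = m1 H

/-- `G` (an `n`-vertex graph) contains an `H`-factor: `⌊n / v(H)⌋` pairwise vertex-disjoint
copies of `H`. -/
def HasFactor {V : Type*} [Fintype V] (H : SimpleGraph V) {n : ℕ}
    (G : SimpleGraph (Fin n)) : Prop :=
  ∃ f : Fin (n / Fintype.card V) × V → Fin n, Function.Injective f ∧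
    ∀ (i : Fin (n / Fintype.card V)) ⦃u v : V⦄, H.Adj u v → G.Adj (f (i, u)) (f (i, v))

section Prob
variable {E : Type*} [Fintype E] [DecidableEq E]

/-- Weight of a set under the product measure. -/
noncomputable def wt (p : ℝ) (W : Finset E) : ℝ := ∏ e, if e ∈ W then p else 1 - p

/-- Expectation under the product measure. -/
noncomputable def pr (p : ℝ) (F : Finset E → ℝ) : ℝ := ∑ W, wt p W * F W

lemma wt_nonneg {p : ℝ} (h0 : 0 ≤ p) (h1 : p ≤ 1) (W : Finset E) : 0 ≤ wt p W := by
  unfold wt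
  apply Finset.prod_nonneg
  intro e _
  split_ifs <;> linarith

/-- Finsets as Boolean functions. -/
def finsetBool : Finset E ≃ (E → Bool) where
  toFun W := fun e => decide (e ∈ W)
  invFun f := Finset.univ.filter fun e => f e = true
  left_inv W := by ext e; simp
  right_inv f := by ext e; simp

lemma wt_symm (p : ℝ) (f : E → Bool) :
    wt p (finsetBool.symm f) = ∏ e, if f e = true then p else 1 - p := by
  unfold wt finsetBool
  simp

lemma pr_eq_bool (p : ℝ) (F : Finset E → ℝ) :
    pr p F = ∑ f : E → Bool, (∏ e, if f e = true then p else 1 - p) * F (finsetBool.symm f) := by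
  unfold pr
  rw [← Equiv.sum_comp (finsetBool (E := E)).symm]
  simp only [wt_symm]

lemma pr_union (p₁ p₂ : ℝ) (F : Finset E → ℝ) :
    pr p₁ (fun W₁ => pr p₂ (fun W₂ => F (W₁ ∪ W₂))) = pr (p₁ + p₂ - p₁ * p₂) F := by
  simp only [pr_eq_bool, Finset.mul_sum]
  rw [← Fintype.sum_prod_type' (f := fun f g : E → Bool =>
    (∏ e, if f e = true then p₁ else 1 - p₁) * ((∏ e, if g e = true then p₂ else 1 - p₂) *
      F (finsetBool.symm f ∪ finsetBool.symm g)))]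
  rw [← Equiv.sum_comp (Equiv.arrowProdEquivProdArrow E (fun _ => Bool) (fun _ => Bool))]
  rw [← Finset.sum_fiberwise (s := Finset.univ)
    (g := fun (h : E → Bool × Bool) => fun e => (h e).1 || (h e).2)]
  apply Finset.sum_congr rfl
  intro f _
  have key : ∀ h ∈ Finset.univ.filter
      (fun h : E → Bool × Bool => (fun e => (h e).1 || (h e).2) = f),
      (∏ e, if (h e).1 = true then p₁ else 1 - p₁) * ((∏ e, if (h e).2 = true then p₂ else 1 - p₂) *
        F (finsetBool.symm (fun e => (h e).1) ∪ finsetBool.symm (fun e => (h e).2))) =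
      (∏ e, (if (h e).1 = true then p₁ else 1 - p₁) * (if (h e).2 = true then p₂ else 1 - p₂))
        * F (finsetBool.symm f) := by
    intro h hh
    rw [Finset.mem_filter] at hh
    rw [Finset.prod_mul_distrib, mul_assoc]
    congr 3
    rw [← hh.2]
    ext e
    simp [finsetBool]
  have e1 := Finset.sum_congr rfl key
  refine Eq.trans e1 ?_
  rw [← Finset.sum_mul]
  congr 1
  have : Finset.univ.filter (fun h : E → Bool × Bool => (fun e => (h e).1 || (h e).2) = f)
      = Fintype.piFinset (fun e => Finset.univ.filter fun x : Bool × Bool => (x.1 || x.2) = f e) := by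
    ext h
    simp [Fintype.mem_piFinset, funext_iff]
  rw [this]
  rw [← Finset.prod_univ_sum (fun e => Finset.univ.filter fun x : Bool × Bool => (x.1 || x.2) = f e)
    (fun _ (x : Bool × Bool) => (if x.1 = true then p₁ else 1 - p₁) * (if x.2 = true then p₂ else 1 - p₂))]
  apply Finset.prod_congr rfl
  intro e _
  rw [Finset.sum_filter, Fintype.sum_prod_type]
  cases f e <;> simp <;> ring

lemma pr_const (p : ℝ) (c : ℝ) : pr p (fun _ : Finset E => c) = c := by
  rw [pr_eq_bool, ← Finset.sum_mul]
  have := Finset.sum_prod_piFinset (ι := E) (R := ℝ) (Finset.univ : Finset Bool)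
    (fun _ x => if x = true then p else 1 - p)
  rw [Fintype.piFinset_univ] at this
  rw [this]
  simp

lemma pr_mono {p : ℝ} (h0 : 0 ≤ p) (h1 : p ≤ 1) {F G : Finset E → ℝ} (h : ∀ W, F W ≤ G W) :
    pr p F ≤ pr p G :=
  Finset.sum_le_sum fun W _ => mul_le_mul_of_nonneg_left (h W) (wt_nonneg h0 h1 W)

lemma pr_anti {p p' : ℝ} (h0 : 0 ≤ p) (hpp : p ≤ p') (h1 : p' ≤ 1) {F : Finset E → ℝ}
    (hF : ∀ W W', W ⊆ W' → F W' ≤ F W) : pr p' F ≤ pr p F := by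
  rcases eq_or_lt_of_le (hpp.trans h1) with h | h
  · have : p = p' := le_antisymm hpp (by linarith)
    rw [this]
  · have hp : p' = p + (p' - p) / (1 - p) - p * ((p' - p) / (1 - p)) := by
      have : 1 - p ≠ 0 := by linarith
      field_simp
      ring
    rw [hp, ← pr_union]
    have a0 : 0 ≤ (p' - p) / (1 - p) := div_nonneg (by linarith) (by linarith)
    have a1 : (p' - p) / (1 - p) ≤ 1 := by rw [div_le_one (by linarith)]; linarith
    refine pr_mono h0 h.le fun W => ?_
    calc _ ≤ pr ((p' - p) / (1 - p)) (fun _ : Finset E => F W) :=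
          pr_mono a0 a1 fun W' => hF _ _ Finset.subset_union_left
      _ = _ := pr_const _ _

lemma pr_add (p : ℝ) (F G : Finset E → ℝ) : pr p (fun W => F W + G W) = pr p F + pr p G := by
  unfold pr
  simp only [mul_add, Finset.sum_add_distrib]

lemma pr_mul_right (p : ℝ) (F : Finset E → ℝ) (c : ℝ) : pr p (fun W => F W * c) = pr p F * c := by
  unfold pr
  rw [Finset.sum_mul]
  exact Finset.sum_congr rfl fun _ _ => by ring

lemma wt_shift {p : ℝ} (h0 : 0 ≤ p) (h1 : p ≤ 1) (W T : Finset E) :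
    wt p W * p ^ T.card ≤ wt p (W ∪ T) := by
  have : p ^ T.card = ∏ e, if e ∈ T then p else 1 := by
    rw [Finset.prod_ite_mem, Finset.univ_inter, Finset.prod_const]
  rw [this]
  unfold wt
  rw [← Finset.prod_mul_distrib]
  apply Finset.prod_le_prod
  · intro e _
    have : 0 ≤ 1 - p := by linarith
    split_ifs <;> positivity
  · intro e _
    by_cases hW : e ∈ W <;> by_cases hT : e ∈ T <;> simp [hW, hT] <;> nlinarith

end Prob
section Frag
set_option linter.unusedSectionVars false
variable {E I : Type*} [Fintype E] [DecidableEq E] [DecidableEq I]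

open Classical in
lemma frag {p q M ℓ : ℝ} (hp0 : 0 < p) (hp1 : p ≤ 1) (hq : 0 ≤ q) (hM : 0 ≤ M) (hℓ : 0 ≤ ℓ)
    (J : Finset I) (S : I → Finset E)
    (hs : ∀ A : Finset E, ((J.filter fun i => A ⊆ S i).card : ℝ) ≤ M * q ^ A.card)
    (hl : ∀ i ∈ J, ((S i).card : ℝ) ≤ ℓ) :
    ∃ c : Finset E → I → I, (∀ W, ∀ i ∈ J, c W i ∈ J ∧ S (c W i) \ W ⊆ S i) ∧
      ∀ a s : ℝ, 0 ≤ a → 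
      pr p (fun W => ((J.filter fun i => s ≤ ((S (c W i) \ W).card : ℝ)).card : ℝ)) ≤
        M * (Real.exp (-(a * s)) * Real.exp (Real.exp a * (q / p) * ℓ)) := by
  have hex : ∀ (W : Finset E) (i : I), ∃ j, i ∈ J → (j ∈ J ∧ S j ⊆ S i ∪ W ∧
      ∀ k ∈ J, S k ⊆ S i ∪ W → (S j \ W).card ≤ (S k \ W).card) := by
    intro W i
    by_cases hi : i ∈ J
    · obtain ⟨j, hj, hmin⟩ := Finset.exists_min_image (J.filter fun j => S j ⊆ S i ∪ W)
        (fun j => (S j \ W).card) ⟨i, by simp [hi]⟩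
      rw [Finset.mem_filter] at hj
      exact ⟨j, fun _ => ⟨hj.1, hj.2, fun k hk hk' => hmin k (by simp [hk, hk'])⟩⟩
    · exact ⟨i, fun h => absurd h hi⟩
  choose c hc using hex
  have hTS : ∀ W, ∀ i ∈ J, S (c W i) \ W ⊆ S i := by
    intro W i hi e he
    rw [Finset.mem_sdiff] at he
    have := (hc W i hi).2.1 he.1
    rw [Finset.mem_union] at this
    tauto
  refine ⟨c, fun W i hi => ⟨(hc W i hi).1, hTS W i hi⟩, ?_⟩
  intro a s ha
  -- the canonical edge inside Z
  let Sh : Finset E → Finset E := fun Z => if h : ∃ j ∈ J, S j ⊆ Z then S h.choose else ∅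
  have hSh : ∀ Z, ((Sh Z).card : ℝ) ≤ ℓ := by
    intro Z
    simp only [Sh]
    split_ifs with h
    · exact hl _ h.choose_spec.1
    · simpa using hℓ
  have hTSh : ∀ W, ∀ i ∈ J, S (c W i) \ W ⊆ Sh (W ∪ (S (c W i) \ W)) := by
    intro W i hi
    have h : ∃ j ∈ J, S j ⊆ W ∪ (S (c W i) \ W) := ⟨c W i, (hc W i hi).1, by
      intro e he
      by_cases h : e ∈ W <;> simp [h, he]⟩
    have e1 : Sh (W ∪ (S (c W i) \ W)) = S h.choose := by
      simp only [Sh]; rw [dif_pos h]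
    rw [e1]
    obtain ⟨hj, hjs⟩ := h.choose_spec
    set j := h.choose
    have sub : S j \ W ⊆ S (c W i) \ W := by
      intro e he
      rw [Finset.mem_sdiff] at he
      have := hjs he.1
      rw [Finset.mem_union] at this
      tauto
    have hle := (hc W i hi).2.2 j hj (by
      intro e he
      have := hjs he
      rw [Finset.mem_union] at this ⊢
      rcases this with h | h
      · exact Or.inr h
      · exact Or.inl (hTS W i hi h))
    have := Finset.eq_of_subset_of_card_le sub hle
    rw [← this]
    exact Finset.sdiff_subset
  set x : ℝ := Real.exp a / p with hx
  have hx0 : 0 < x := by positivity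
  let g : Finset E × Finset E × I → ℝ := fun y =>
    if y.2.1 ⊆ Sh y.1 ∧ y.2.1 ⊆ S y.2.2 then wt p y.1 * x ^ y.2.1.card else 0
  have hg0 : ∀ y, 0 ≤ g y := by
    intro y
    simp only [g]
    have := wt_nonneg hp0.le hp1 y.1
    split_ifs <;> positivity
  let Φ : Finset E × I → Finset E × Finset E × I := fun z =>
    (z.1 ∪ (S (c z.1 z.2) \ z.1), S (c z.1 z.2) \ z.1, z.2)
  have hΦ : Function.Injective Φ := by
    rintro ⟨W, i⟩ ⟨W', i'⟩ h
    simp only [Φ, Prod.mk.injEq] at h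
    obtain ⟨h1, h2, h3⟩ := h
    have e1 : ∀ W T : Finset E, (W ∪ (T \ W)) \ (T \ W) = W := by
      intro W T; ext e; simp; tauto
    have : W = W' := by
      rw [← e1 W (S (c W i)), ← e1 W' (S (c W' i')), h1, h2]
    simp [this, h3]
  have step1 : pr p (fun W => ((J.filter fun i => s ≤ ((S (c W i) \ W).card : ℝ)).card : ℝ)) ≤
      Real.exp (-(a * s)) * ∑ z ∈ Finset.univ ×ˢ J, g (Φ z) := by
    unfold pr
    rw [Finset.sum_product, Finset.mul_sum]
    apply Finset.sum_le_sum
    intro W _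
    beta_reduce
    rw [Finset.card_filter]
    push_cast
    rw [Finset.mul_sum, Finset.mul_sum]
    apply Finset.sum_le_sum
    intro i hi
    have hgv : g (Φ (W, i)) = wt p (W ∪ (S (c W i) \ W)) * x ^ (S (c W i) \ W).card := by
      simp only [g, Φ]
      rw [if_pos ⟨hTSh W i hi, hTS W i hi⟩]
    rw [hgv]
    set T := S (c W i) \ W
    have hw := wt_shift hp0.le hp1 W T
    have hw0 := wt_nonneg hp0.le hp1 W
    have e2 : Real.exp a ^ T.card = Real.exp (a * T.card) := by
      rw [← Real.exp_nat_mul, mul_comm]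
    have h3 : wt p W * Real.exp (a * T.card) ≤ wt p (W ∪ T) * x ^ T.card := by
      rw [hx, div_pow, ← mul_div_assoc, le_div_iff₀ (by positivity), e2]
      nlinarith [Real.exp_pos (a * T.card)]
    have h4 : wt p W * (if s ≤ (T.card : ℝ) then (1:ℝ) else 0) ≤
        Real.exp (-(a*s)) * (wt p W * Real.exp (a * T.card)) := by
      have : Real.exp (-(a*s)) * (wt p W * Real.exp (a * T.card)) =
        wt p W * Real.exp (a * (T.card - s)) := by
        rw [mul_sub, sub_eq_add_neg, Real.exp_add]; ring
      rw [this]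
      apply mul_le_mul_of_nonneg_left _ hw0
      split_ifs with h
      · rw [← Real.exp_zero]
        apply Real.exp_le_exp.2
        have : 0 ≤ (T.card : ℝ) - s := by linarith
        positivity
      · positivity
    exact h4.trans (mul_le_mul_of_nonneg_left h3 (Real.exp_pos _).le)
  have step2 : ∑ z ∈ Finset.univ ×ˢ J, g (Φ z) ≤
      ∑ y ∈ Finset.univ ×ˢ (Finset.univ ×ˢ J), g y := by
    rw [← Finset.sum_image (f := g) (g := Φ) (fun _ _ _ _ h => hΦ h)]
    apply Finset.sum_le_sum_of_subset_of_nonneg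
    · intro y hy
      rw [Finset.mem_image] at hy
      obtain ⟨z, hz, rfl⟩ := hy
      simp only [Finset.mem_product, Finset.mem_univ, true_and] at hz ⊢
      exact hz
    · intro y _ _
      exact hg0 y
  have step3 : ∑ y ∈ Finset.univ ×ˢ (Finset.univ ×ˢ J), g y ≤
      M * Real.exp (Real.exp a * (q / p) * ℓ) := by
    rw [Finset.sum_product]
    calc _ ≤ ∑ Z : Finset E, wt p Z * (M * Real.exp (Real.exp a * (q / p) * ℓ)) := by
          apply Finset.sum_le_sum
          intro Z _
          rw [Finset.sum_product]
          have hw0 := wt_nonneg hp0.le hp1 Z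
          calc _ ≤ ∑ T : Finset E, if T ∈ (Sh Z).powerset then wt p Z * (M * (x * q) ^ T.card) else 0 := by
                apply Finset.sum_le_sum
                intro T _
                by_cases hT : T ⊆ Sh Z
                · have : ∑ i ∈ J, g (Z, T, i) =
                      (wt p Z * x ^ T.card) * ((J.filter fun i => T ⊆ S i).card : ℝ) := by
                    rw [Finset.card_filter]
                    push_cast
                    rw [Finset.mul_sum]
                    apply Finset.sum_congr rfl
                    intro i _
                    simp [g, hT]
                  rw [this, if_pos (Finset.mem_powerset.2 hT)]
                  calc _ ≤ (wt p Z * x ^ T.card) * (M * q ^ T.card) :=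
                        mul_le_mul_of_nonneg_left (hs T) (by positivity)
                    _ = _ := by rw [mul_pow]; ring
                · rw [if_neg (by simpa using hT)]
                  apply le_of_eq
                  apply Finset.sum_eq_zero
                  intro i _
                  simp [g, hT]
            _ = wt p Z * (M * (x * q + 1) ^ (Sh Z).card) := by
                rw [Finset.sum_ite_mem, Finset.univ_inter, ← Finset.mul_sum, ← Finset.mul_sum,
                  ← Finset.sum_pow_mul_eq_add_pow]
                simp
            _ ≤ _ := by
                apply mul_le_mul_of_nonneg_left _ hw0
                apply mul_le_mul_of_nonneg_left _ hM
                calc (x * q + 1) ^ (Sh Z).card ≤ Real.exp (x * q) ^ (Sh Z).card := by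
                      apply pow_le_pow_left₀ (by positivity)
                      exact Real.add_one_le_exp _
                  _ = Real.exp ((Sh Z).card * (x * q)) := by rw [Real.exp_nat_mul]
                  _ ≤ _ := by
                      apply Real.exp_le_exp.2
                      have e3 : Real.exp a * (q / p) * ℓ = ℓ * (x * q) := by
                        rw [hx]; ring
                      rw [e3]
                      exact mul_le_mul_of_nonneg_right (hSh Z) (by positivity)
      _ = _ := pr_const (E := E) p _
  calc _ ≤ _ := step1
    _ ≤ Real.exp (-(a * s)) * (M * Real.exp (Real.exp a * (q / p) * ℓ)) :=
      mul_le_mul_of_nonneg_left (step2.trans step3) (Real.exp_pos _).le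
    _ = _ := by ring

lemma exp_two_le : Real.exp 2 ≤ 8 := by
  have h := Real.exp_one_lt_d9
  have : Real.exp 2 = Real.exp 1 * Real.exp 1 := by rw [← Real.exp_add]; norm_num
  rw [this]
  nlinarith [Real.exp_pos 1]

/-- The failure indicator. -/
noncomputable def failInd (J : Finset I) (S : I → Finset E) (W : Finset E) : ℝ :=
  open Classical in if ∃ i ∈ J, S i ⊆ W then 0 else 1

lemma failInd_anti (J : Finset I) (S : I → Finset E) (W W' : Finset E) (h : W ⊆ W') :
    failInd J S W' ≤ failInd J S W := by
  unfold failInd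
  by_cases h1 : ∃ i ∈ J, S i ⊆ W
  · have h2 : ∃ i ∈ J, S i ⊆ W' := by
      obtain ⟨i, hi, hs⟩ := h1
      exact ⟨i, hi, hs.trans h⟩
    rw [if_pos h1, if_pos h2]
  · rw [if_neg h1]
    split_ifs <;> norm_num

open Classical in
lemma iter {p q M b y : ℝ} (hp0 : 0 < p) (hp1 : p ≤ 1) (hq : 0 ≤ q) (hM : 0 ≤ M)
    (hr : 8 * (q / p) ≤ 1) (hb : 0 ≤ b) (hy0 : 0 < y) (hy1 : y ≤ 1) (hby : q / p * b ≤ y) (K : ℕ) :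
    ∀ (ℓ : ℝ) (_ : 0 ≤ ℓ) (J : Finset I) (S : I → Finset E)
    (_ : ∀ A : Finset E, ((J.filter fun i => A ⊆ S i).card : ℝ) ≤ M * q ^ A.card)
    (_ : ∀ i ∈ J, ((S i).card : ℝ) ≤ ℓ) (_ : (8 * (q / p)) ^ K * ℓ ≤ b),
    pr (1 - (1 - p) ^ (K + 1)) (failInd J S) * J.card ≤ M * (3 * y + K * Real.exp (-b)) := by
  have hr0 : 0 ≤ q / p := by positivity
  induction K with
  | zero =>
    intro ℓ hℓ J S hs hl hK
    obtain ⟨c, hc, hbd⟩ := frag hp0 hp1 hq hM hℓ J S hs hl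
    have h := hbd (-Real.log y) 1 (by have := Real.log_nonpos hy0.le hy1; linarith)
    have e1 : Real.exp (-Real.log y) = y⁻¹ := by rw [Real.exp_neg, Real.exp_log hy0]
    have hmain : pr (1 - (1 - p) ^ (0 + 1)) (failInd J S) * J.card ≤
        pr p (fun W => ((J.filter fun i => (1:ℝ) ≤ ((S (c W i) \ W).card : ℝ)).card : ℝ)) := by
      rw [← pr_mul_right]
      have : (1 - (1 - p) ^ (0 + 1)) = p := by ring
      rw [this]
      apply pr_mono hp0.le hp1
      intro W
      unfold failInd
      split_ifs with h
      · simp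
      · rw [one_mul]
        have : (J.filter fun i => (1:ℝ) ≤ ((S (c W i) \ W).card : ℝ)) = J := by
          apply Finset.filter_true_of_mem
          intro i hi
          norm_cast
          rw [Nat.one_le_iff_ne_zero, Finset.card_ne_zero, Finset.sdiff_nonempty]
          intro h'
          exact h ⟨c W i, (hc W i hi).1, h'⟩
        rw [this]
    refine hmain.trans (h.trans ?_)
    apply mul_le_mul_of_nonneg_left _ hM
    rw [e1]
    have e2 : Real.exp (-(-Real.log y * 1)) = y := by
      rw [mul_one, neg_neg, Real.exp_log hy0]
    rw [e2]
    have e3 : y⁻¹ * (q / p) * ℓ ≤ 1 := by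
      rw [pow_zero, one_mul] at hK
      calc y⁻¹ * (q / p) * ℓ = (q / p * ℓ) / y := by ring
        _ ≤ (q / p * b) / y := by gcongr
        _ ≤ 1 := by rw [div_le_one hy0]; exact hby
    have := Real.exp_le_exp.2 e3
    have := Real.exp_one_lt_d9
    simp only [Nat.cast_zero, zero_mul, add_zero]
    nlinarith
  | succ K ih =>
    intro ℓ hℓ J S hs hl hK
    obtain ⟨c, hc, hbd⟩ := frag hp0 hp1 hq hM hℓ J S hs hl
    set s := max (8 * (q / p) * ℓ) b with hsdef
    have hs8 : 8 * (q / p) * ℓ ≤ s := le_max_left _ _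
    have hsb : b ≤ s := le_max_right _ _
    have hs0 : 0 ≤ s := hb.trans hsb
    have h := hbd 2 s (by norm_num)
    have hbad : pr p (fun W => ((J.filter fun i => s ≤ ((S (c W i) \ W).card : ℝ)).card : ℝ)) ≤
        M * Real.exp (-b) := by
      refine h.trans ?_
      apply mul_le_mul_of_nonneg_left _ hM
      rw [← Real.exp_add]
      apply Real.exp_le_exp.2
      have : Real.exp 2 * (q / p) * ℓ ≤ 8 * (q / p) * ℓ := by
        have := exp_two_le
        gcongr
      linarith
    have hpp : (1 - (1 - p) ^ (K + 1 + 1)) =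
        p + (1 - (1 - p) ^ (K + 1)) - p * (1 - (1 - p) ^ (K + 1)) := by ring
    rw [hpp, ← pr_union, ← pr_mul_right]
    have hpK0 : 0 ≤ 1 - (1 - p) ^ (K + 1) := by
      have := pow_le_one₀ (n := K + 1) (by linarith : 0 ≤ 1 - p) (by linarith)
      linarith
    have hpK1 : 1 - (1 - p) ^ (K + 1) ≤ 1 := by
      have := pow_nonneg (by linarith : 0 ≤ 1 - p) (K + 1)
      linarith
    have hW : ∀ W, pr (1 - (1 - p) ^ (K + 1)) (fun W₂ => failInd J S (W ∪ W₂)) * (J.card : ℝ) ≤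
        M * (3 * y + K * Real.exp (-b)) +
        ((J.filter fun i => s ≤ ((S (c W i) \ W).card : ℝ)).card : ℝ) := by
      intro W
      set J' := J.filter fun i => ¬ s ≤ ((S (c W i) \ W).card : ℝ) with hJ'
      have hcard : (J.card : ℝ) = (J'.card : ℝ) +
        ((J.filter fun i => s ≤ ((S (c W i) \ W).card : ℝ)).card : ℝ) := by
        rw [add_comm]
        exact_mod_cast (Finset.card_filter_add_card_filter_not _).symm
      have hJJ : J' ⊆ J := Finset.filter_subset _ _
      have hih := ih s hs0 J' (fun i => S (c W i) \ W) (by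
        intro A
        refine le_trans ?_ (hs A)
        norm_cast
        apply Finset.card_le_card
        intro i hi
        rw [Finset.mem_filter] at hi ⊢
        exact ⟨hJJ hi.1, hi.2.trans (hc W i (hJJ hi.1)).2⟩) (by
        intro i hi
        rw [hJ', Finset.mem_filter] at hi
        exact (not_le.1 hi.2).le) (by
        rcases max_choice (8 * (q / p) * ℓ) b with h | h
        · rw [hsdef, h]
          refine le_trans (le_of_eq ?_) hK
          ring
        · rw [hsdef, h]
          have := pow_le_one₀ (n := K) (by positivity) hr
          nlinarith)
      have hle : pr (1 - (1 - p) ^ (K + 1)) (fun W₂ => failInd J S (W ∪ W₂)) ≤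
          pr (1 - (1 - p) ^ (K + 1)) (failInd J' (fun i => S (c W i) \ W)) := by
        apply pr_mono hpK0 hpK1
        intro W₂
        unfold failInd
        by_cases h1 : ∃ i ∈ J', S (c W i) \ W ⊆ W₂
        · obtain ⟨i, hi, h2⟩ := h1
          rw [if_pos ⟨c W i, (hc W i (hJJ hi)).1, by
            intro e he
            by_cases hW' : e ∈ W
            · exact Finset.mem_union_left _ hW'
            · exact Finset.mem_union_right _ (h2 (Finset.mem_sdiff.2 ⟨he, hW'⟩))⟩, if_pos ⟨i, hi, h2⟩]
        · rw [if_neg h1]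
          split_ifs <;> norm_num
      have hle1 : pr (1 - (1 - p) ^ (K + 1)) (fun W₂ => failInd J S (W ∪ W₂)) ≤ 1 := by
        refine (pr_mono hpK0 hpK1 (G := fun _ => (1:ℝ)) ?_).trans (le_of_eq (pr_const _ _))
        intro W₂
        unfold failInd
        split_ifs <;> norm_num
      rw [hcard, mul_add]
      apply add_le_add
      · exact (mul_le_mul_of_nonneg_right hle (by positivity)).trans hih
      · exact mul_le_of_le_one_left (by positivity) hle1
    refine (pr_mono hp0.le hp1 hW).trans ?_
    rw [pr_add, pr_const]
    push_cast
    nlinarith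
end Frag
section Spread
set_option linter.unusedSectionVars false
variable {X V : Type*} [Fintype X] [DecidableEq X] [Fintype V] [DecidableEq V]

open Classical in
/-- Injections of `X` into `Y`. -/
noncomputable def embs (X : Type*) {V : Type*} [Fintype X] [DecidableEq X] [Fintype V] [DecidableEq V]
    (Y : Finset V) : Finset (X → V) :=
  Finset.univ.filter fun f => Function.Injective f ∧ ∀ x, f x ∈ Y

open Classical in
/-- The edge set of the image of `H` under `f`. -/
noncomputable def edgeImg (H : SimpleGraph X) (f : X → V) : Finset (Sym2 V) :=
  Finset.univ.filter fun e => ∃ u v, H.Adj u v ∧ e = s(f u, f v)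

open Classical in
/-- Injections that cover `B` and map edges onto the edges of `A` inside `B`. -/
noncomputable def gS (H : SimpleGraph X) (Y : Finset V) (A : Finset (Sym2 V)) (B : Finset V) :
    Finset (X → V) :=
  (embs X Y).filter fun f => (∀ b ∈ B, ∃ x, f x = b) ∧
    ∀ a ∈ B, ∀ b ∈ B, s(a, b) ∈ A → ∃ u v, H.Adj u v ∧ f u = a ∧ f v = b

lemma mem_embs {Y : Finset V} {f : X → V} :
    f ∈ embs X Y ↔ Function.Injective f ∧ ∀ x, f x ∈ Y := by
  simp [embs]

lemma mem_edgeImg {H : SimpleGraph X} {f : X → V} {e : Sym2 V} :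
    e ∈ edgeImg H f ↔ ∃ u v, H.Adj u v ∧ e = s(f u, f v) := by
  simp [edgeImg]

lemma pair_mem_edgeImg {H : SimpleGraph X} {f : X → V} {a b : V} :
    s(a, b) ∈ edgeImg H f ↔ ∃ u v, H.Adj u v ∧ f u = a ∧ f v = b := by
  rw [mem_edgeImg]
  constructor
  · rintro ⟨u, v, h, e⟩
    rw [Sym2.eq_iff] at e
    rcases e with ⟨h1, h2⟩ | ⟨h1, h2⟩
    · exact ⟨u, v, h, h1.symm, h2.symm⟩
    · exact ⟨v, u, h.symm, h1.symm, h2.symm⟩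
  · rintro ⟨u, v, h, h1, h2⟩
    exact ⟨u, v, h, by rw [h1, h2]⟩

open Classical in
lemma ext_step (H : SimpleGraph X) (Y : Finset V) (A : Finset (Sym2 V)) (B : Finset V) (b : V)
    (hb : b ∉ B) (N k : ℕ) (hN : Fintype.card X + N ≤ Y.card) (P : (X → V) → Finset X)
    (hP : ∀ f ∈ gS H Y A B, (P f).card ≤ k)
    (hmem : ∀ f ∈ gS H Y A (insert b B), ∀ x, f x = b → ∀ y, (∀ z, f z ≠ y) →
      x ∈ P (Function.update f x y)) :
    N * (gS H Y A (insert b B)).card ≤ k * (gS H Y A B).card := by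
  have h1 : N * (gS H Y A (insert b B)).card ≤
      ((gS H Y A (insert b B)).sigma fun f =>
        (Y \ Finset.univ.image f) ×ˢ (Finset.univ.filter fun x => f x = b)).card := by
    rw [Finset.card_sigma, mul_comm, ← smul_eq_mul]
    apply Finset.card_nsmul_le_sum
    intro f hf
    rw [gS, Finset.mem_filter] at hf
    rw [Finset.card_product]
    have c1 : N ≤ (Y \ Finset.univ.image f).card := by
      have := Finset.le_card_sdiff (Finset.univ.image f) Y
      have h2 : (Finset.univ.image f).card ≤ Fintype.card X := Finset.card_image_le
      omega
    have c2 : 1 ≤ (Finset.univ.filter fun x => f x = b).card := by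
      obtain ⟨x, hx⟩ := hf.2.1 b (Finset.mem_insert_self _ _)
      exact Finset.card_pos.2 ⟨x, by simp [hx]⟩
    nlinarith
  have h2 : ((gS H Y A B).sigma P).card ≤ k * (gS H Y A B).card := by
    rw [Finset.card_sigma, mul_comm, ← smul_eq_mul]
    exact Finset.sum_le_card_nsmul _ _ _ hP
  refine h1.trans (le_trans ?_ h2)
  apply Finset.card_le_card_of_injOn (fun z => ⟨Function.update z.1 z.2.2 z.2.1, z.2.2⟩)
  · rintro ⟨f, y, x⟩ hz
    simp only [Finset.coe_sigma, Set.mem_sigma_iff, Finset.mem_coe, Finset.mem_product,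
      Finset.mem_sdiff, Finset.mem_image, Finset.mem_univ, true_and, Finset.mem_filter] at hz ⊢
    obtain ⟨hf, ⟨hyY, hy⟩, hx⟩ := hz
    have hy' : ∀ z, f z ≠ y := fun z hz => hy ⟨z, hz⟩
    refine ⟨?_, hmem f hf x hx y hy'⟩
    simp only [gS, Finset.mem_filter, mem_embs] at hf ⊢
    obtain ⟨⟨hinj, hfY⟩, hcov, hed⟩ := hf
    have hne : ∀ a ∈ B, ∀ u, f u = a → u ≠ x := by
      rintro a ha u hu rfl
      rw [hx] at hu
      exact hb (hu ▸ ha)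
    refine ⟨⟨?_, ?_⟩, ?_, ?_⟩
    · intro u v huv
      by_cases hu : u = x <;> by_cases hv : v = x
      · rw [hu, hv]
      · subst hu
        rw [Function.update_self, Function.update_of_ne hv] at huv
        exact absurd huv.symm (hy' v)
      · subst hv
        rw [Function.update_self, Function.update_of_ne hu] at huv
        exact absurd huv (hy' u)
      · rw [Function.update_of_ne hu, Function.update_of_ne hv] at huv
        exact hinj huv
    · intro u
      by_cases hu : u = x
      · subst hu
        rw [Function.update_self]; exact hyY
      · rw [Function.update_of_ne hu]; exact hfY u
    · intro a ha
      obtain ⟨u, hu⟩ := hcov a (Finset.mem_insert_of_mem ha)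
      exact ⟨u, by rw [Function.update_of_ne (hne a ha u hu), hu]⟩
    · intro a ha c hc hac
      obtain ⟨u, v, huv, hu, hv⟩ := hed a (Finset.mem_insert_of_mem ha) c
        (Finset.mem_insert_of_mem hc) hac
      exact ⟨u, v, huv, by rw [Function.update_of_ne (hne a ha u hu), hu],
        by rw [Function.update_of_ne (hne c hc v hv), hv]⟩
  · rintro ⟨f, y, x⟩ hz ⟨f', y', x'⟩ hz' heq
    simp only [Finset.coe_sigma, Set.mem_sigma_iff, Finset.mem_coe, Finset.mem_product,
      Finset.mem_sdiff, Finset.mem_image, Finset.mem_univ, true_and, Finset.mem_filter] at hz hz'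
    simp only [Sigma.mk.injEq, heq_eq_eq] at heq
    obtain ⟨h3, h4⟩ := heq
    subst h4
    have hy : y = y' := by
      have := congrFun h3 x
      simpa using this
    have hff : f = f' := by
      funext u
      by_cases hu : u = x
      · rw [hu, hz.2.2, hz'.2.2]
      · have := congrFun h3 u
        simpa [Function.update_of_ne hu] using this
    subst hy hff
    rfl

open Classical in
lemma spread (H : SimpleGraph X) (Y : Finset V) (N Δ : ℕ) (hN0 : 0 < N)
    (hN : Fintype.card X + N ≤ Y.card)
    (hdeg : ∀ x, (Finset.univ.filter fun z => H.Adj x z).card ≤ Δ)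
    {d R q : ℝ} (hR1 : 1 ≤ R) (hR : (Fintype.card X : ℝ) ≤ R * N)
    (hq0 : 0 < q) (hq1 : q ≤ 1) (hq : R * (Δ / N) ≤ q ^ d)
    (hD : ∀ C : Finset X, C.Nonempty →
      ((Finset.univ.filter fun e : Sym2 X => e ∈ H.edgeSet ∧ ∀ x ∈ e, x ∈ C).card : ℝ) ≤
        d * ((C.card : ℝ) - 1))
    (A : Finset (Sym2 V)) :
    (((embs X Y).filter fun f => A ⊆ edgeImg H f).card : ℝ) ≤
      ((embs X Y).card : ℝ) * q ^ A.card := by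
  rcases Finset.eq_empty_or_nonempty ((embs X Y).filter fun f => A ⊆ edgeImg H f) with h0 | h0
  · rw [h0]; simp; positivity
  obtain ⟨f₀, hf₀⟩ := h0
  rw [Finset.mem_filter, mem_embs] at hf₀
  obtain ⟨⟨hinj, hfY⟩, hA⟩ := hf₀
  have hNR : (0 : ℝ) < N := by exact_mod_cast hN0
  set x : ℝ := Δ / N with hx
  have hx0 : 0 ≤ x := by positivity
  let ins : Finset V → Finset (Sym2 V) := fun B => A.filter fun e => ∀ v ∈ e, v ∈ B
  let Good : Finset V → Prop := fun B => (∀ a ∈ B, ∀ b, s(a, b) ∈ A → b ∈ B) ∧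
    (∀ a ∈ B, ∃ b, s(a, b) ∈ A) ∧
    ((gS H Y A B).card : ℝ) ≤ (embs X Y).card * q ^ (ins B).card
  -- extension steps
  have stepRoot : ∀ B b, b ∉ B → ((gS H Y A (insert b B)).card : ℝ) ≤ (gS H Y A B).card * R := by
    intro B b hb
    have h := ext_step H Y A B b hb N (Fintype.card X) hN (fun _ => Finset.univ)
      (fun _ _ => le_rfl) (fun _ _ _ _ _ _ => Finset.mem_univ _)
    have h' : (N : ℝ) * (gS H Y A (insert b B)).card ≤ Fintype.card X * (gS H Y A B).card := by
      exact_mod_cast h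
    have h2 : (Fintype.card X : ℝ) * (gS H Y A B).card ≤ R * N * (gS H Y A B).card := by gcongr
    have h3 : (N : ℝ) * (gS H Y A (insert b B)).card ≤ N * ((gS H Y A B).card * R) := by nlinarith
    exact le_of_mul_le_mul_left h3 hNR
  have stepAdj : ∀ B b b', b ∉ B → b' ∈ B → s(b', b) ∈ A →
      ((gS H Y A (insert b B)).card : ℝ) ≤ (gS H Y A B).card * x := by
    intro B b b' hb hb' hbb
    have h := ext_step H Y A B b hb N Δ hN
      (fun f => Finset.univ.filter fun z => ∃ u, f u = b' ∧ H.Adj u z) (by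
        intro f hf
        rw [gS, Finset.mem_filter, mem_embs] at hf
        obtain ⟨u, hu⟩ := hf.2.1 b' hb'
        refine le_trans (Finset.card_le_card ?_) (hdeg u)
        intro z hz
        simp only [Finset.mem_filter, Finset.mem_univ, true_and] at hz ⊢
        obtain ⟨u', hu', hz⟩ := hz
        rwa [hf.1.1 (hu.trans hu'.symm)]) (by
        intro f hf z hz y hy
        rw [gS, Finset.mem_filter, mem_embs] at hf
        obtain ⟨u, v, huv, hu, hv⟩ := hf.2.2 b' (Finset.mem_insert_of_mem hb') b
          (Finset.mem_insert_self _ _) hbb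
        have : v = z := hf.1.1 (hv.trans hz.symm)
        subst this
        simp only [Finset.mem_filter, Finset.mem_univ, true_and]
        exact ⟨u, by rw [Function.update_of_ne huv.ne, hu], huv⟩)
    have h' : (N : ℝ) * (gS H Y A (insert b B)).card ≤ Δ * (gS H Y A B).card := by
      exact_mod_cast h
    rw [hx, mul_div_assoc', le_div_iff₀ hNR]
    nlinarith
  have good0 : Good ∅ := by
    refine ⟨by simp, by simp, ?_⟩
    have e1 : ins ∅ = ∅ := by
      apply Finset.filter_false_of_mem
      intro e _
      induction e with
      | h a b => exact fun h => by simpa using h a (by simp)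
    rw [e1]
    simp only [Finset.card_empty, pow_zero, mul_one]
    exact_mod_cast Finset.card_le_card (Finset.filter_subset _ _)
  obtain ⟨B, hB, hmax⟩ := Finset.exists_max_image (Finset.univ.filter Good) Finset.card
    ⟨∅, by simp [good0]⟩
  simp only [Finset.mem_filter, Finset.mem_univ, true_and] at hB hmax
  have hall : ins B = A := by
    apply Finset.filter_true_of_mem
    by_contra hcon
    push Not at hcon
    obtain ⟨e, he, v, hv, hvB⟩ := hcon
    obtain ⟨v', rfl⟩ := hv
    -- grow the component of v
    let Gd : Finset V → Prop := fun D => v ∈ D ∧ Disjoint D B ∧ (∀ a ∈ D, ∃ b, s(a, b) ∈ A) ∧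
      ((gS H Y A (B ∪ D)).card : ℝ) ≤ (gS H Y A B).card * (R * x ^ (D.card - 1))
    have gd0 : Gd {v} := by
      refine ⟨by simp, by simpa using hvB, ?_, ?_⟩
      · intro a ha
        rw [Finset.mem_singleton] at ha
        exact ⟨v', by rwa [ha]⟩
      · have := stepRoot B v hvB
        rw [Finset.union_comm, ← Finset.insert_eq]
        simpa using this
    obtain ⟨D, hDg, hDmax⟩ := Finset.exists_max_image (Finset.univ.filter Gd) Finset.card
      ⟨{v}, by simp [gd0]⟩
    simp only [Finset.mem_filter, Finset.mem_univ, true_and] at hDg hDmax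
    obtain ⟨hvD, hdis, hDinc, hDcard⟩ := hDg
    have hDpos : 1 ≤ D.card := Finset.card_pos.2 ⟨v, hvD⟩
    have hclosed : ∀ a ∈ D, ∀ c, s(a, c) ∈ A → c ∈ D := by
      intro a ha c hac
      by_contra hcD
      have hcB : c ∉ B := fun hcB => Finset.disjoint_left.1 hdis ha
        (hB.1 c hcB a (by rwa [Sym2.eq_swap]))
      have hgd : Gd (insert c D) := by
        refine ⟨Finset.mem_insert_of_mem hvD, ?_, ?_, ?_⟩
        · rw [Finset.disjoint_insert_left]; exact ⟨hcB, hdis⟩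
        · intro a' ha'
          rw [Finset.mem_insert] at ha'
          rcases ha' with rfl | ha'
          · exact ⟨a, by rwa [Sym2.eq_swap]⟩
          · exact hDinc a' ha'
        · rw [Finset.union_insert]
          have h1 := stepAdj (B ∪ D) c a (by simp [hcB, hcD]) (by simp [ha]) hac
          refine h1.trans ((mul_le_mul_of_nonneg_right hDcard hx0).trans (le_of_eq ?_))
          rw [Finset.card_insert_of_notMem hcD]
          obtain ⟨t, ht⟩ : ∃ t, D.card = t + 1 := ⟨D.card - 1, by omega⟩
          rw [ht]
          simp only [Nat.add_sub_cancel]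
          rw [pow_succ]
          ring
      have := hDmax _ hgd
      rw [Finset.card_insert_of_notMem hcD] at this
      omega
    have hv'D : v' ∈ D := hclosed v hvD v' he
    have hvv' : v ≠ v' := by
      have := hA he
      rw [pair_mem_edgeImg] at this
      obtain ⟨a, b, hab, rfl, rfl⟩ := this
      exact fun h => hab.ne (hinj h)
    have hD2 : 2 ≤ D.card := by
      have : ({v, v'} : Finset V) ⊆ D := by
        intro z hz
        simp only [Finset.mem_insert, Finset.mem_singleton] at hz
        rcases hz with rfl | rfl <;> assumption
      have h2 := Finset.card_le_card this
      rwa [Finset.card_pair hvv'] at h2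
    -- edges inside D
    have hinsD : ((ins D).card : ℝ) ≤ d * ((D.card : ℝ) - 1) := by
      let C : Finset X := Finset.univ.filter fun z => f₀ z ∈ D
      have hDr : ∀ a ∈ D, ∃ z, f₀ z = a := by
        intro a ha
        obtain ⟨b, hb⟩ := hDinc a ha
        have := hA hb
        rw [pair_mem_edgeImg] at this
        obtain ⟨u, _, _, hu, _⟩ := this
        exact ⟨u, hu⟩
      have hCD : C.card = D.card := by
        rw [← Finset.card_image_of_injective C hinj]
        congr 1
        ext a
        simp only [C, Finset.mem_image, Finset.mem_filter, Finset.mem_univ, true_and]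
        constructor
        · rintro ⟨z, hz, rfl⟩; exact hz
        · intro ha
          obtain ⟨z, rfl⟩ := hDr a ha
          exact ⟨z, ha, rfl⟩
      have hCne : C.Nonempty := Finset.card_pos.1 (by omega)
      rw [← hCD]
      refine le_trans ?_ (hD C hCne)
      norm_cast
      refine le_trans (Finset.card_le_card (t := Finset.image (Sym2.map f₀) _) ?_)
        Finset.card_image_le
      intro e he
      induction e with
      | h a b =>
        simp only [ins, Finset.mem_filter] at he
        have h1 := hA he.1
        rw [pair_mem_edgeImg] at h1
        obtain ⟨u, w, huw, rfl, rfl⟩ := h1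
        rw [Finset.mem_image]
        refine ⟨s(u, w), ?_, by simp⟩
        simp only [Finset.mem_filter, Finset.mem_univ, true_and, C]
        refine ⟨huw, ?_⟩
        intro z hz
        apply he.2
        rw [Sym2.mem_iff] at hz ⊢
        rcases hz with rfl | rfl <;> simp
    have hgood : Good (B ∪ D) := by
      refine ⟨?_, ?_, ?_⟩
      · intro a ha b hab
        rw [Finset.mem_union] at ha ⊢
        rcases ha with ha | ha
        · exact Or.inl (hB.1 a ha b hab)
        · exact Or.inr (hclosed a ha b hab)
      · intro a ha
        rw [Finset.mem_union] at ha
        rcases ha with ha | ha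
        · exact hB.2.1 a ha
        · exact hDinc a ha
      · have hsub : ins (B ∪ D) ⊆ ins B ∪ ins D := by
          intro e he
          induction e with
          | h a b =>
            simp only [ins, Finset.mem_filter, Finset.mem_union, Sym2.mem_iff, forall_eq_or_imp,
              forall_eq] at he ⊢
            obtain ⟨heA, ha, hb⟩ := he
            rcases ha with ha | ha
            · exact Or.inl ⟨heA, ha, hB.1 a ha b heA⟩
            · exact Or.inr ⟨heA, ha, hclosed a ha b heA⟩
        have hcs : (ins (B ∪ D)).card ≤ (ins B).card + (ins D).card :=
          (Finset.card_le_card hsub).trans (Finset.card_union_le _ _)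
        have hkey : R * x ^ (D.card - 1) ≤ q ^ (ins D).card := by
          calc R * x ^ (D.card - 1) ≤ R ^ (D.card - 1) * x ^ (D.card - 1) := by
                apply mul_le_mul_of_nonneg_right _ (by positivity)
                exact le_self_pow₀ hR1 (by omega)
            _ = (R * x) ^ (D.card - 1) := by rw [mul_pow]
            _ ≤ (q ^ d) ^ (D.card - 1) := by
                apply pow_le_pow_left₀ (by positivity) hq
            _ = q ^ (d * ((D.card : ℝ) - 1)) := by
                rw [Real.rpow_mul hq0.le, ← Real.rpow_natCast]
                congr 1
                push_cast [hDpos]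
                ring
            _ ≤ q ^ ((ins D).card : ℝ) := Real.rpow_le_rpow_of_exponent_ge hq0 hq1 hinsD
            _ = q ^ (ins D).card := Real.rpow_natCast _ _
        calc ((gS H Y A (B ∪ D)).card : ℝ) ≤ (gS H Y A B).card * (R * x ^ (D.card - 1)) := hDcard
          _ ≤ ((embs X Y).card * q ^ (ins B).card) * q ^ (ins D).card := by
              apply mul_le_mul hB.2.2 hkey (by positivity) (by positivity)
          _ = (embs X Y).card * q ^ ((ins B).card + (ins D).card) := by rw [pow_add]; ring
          _ ≤ _ := by
              apply mul_le_mul_of_nonneg_left _ (by positivity)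
              exact pow_le_pow_of_le_one hq0.le hq1 hcs
    have := hmax _ hgood
    rw [Finset.card_union_of_disjoint hdis.symm] at this
    omega
  have hfin := hB.2.2
  rw [hall] at hfin
  refine le_trans ?_ hfin
  norm_cast
  apply Finset.card_le_card
  intro f hf
  rw [Finset.mem_filter] at hf
  rw [gS, Finset.mem_filter]
  refine ⟨hf.1, ?_, ?_⟩
  · intro b hb
    obtain ⟨c, hc⟩ := hB.2.1 b hb
    have := hf.2 hc
    rw [pair_mem_edgeImg] at this
    obtain ⟨u, _, _, hu, _⟩ := this
    exact ⟨u, hu⟩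
  · intro a _ b _ hab
    have := hf.2 hab
    rwa [pair_mem_edgeImg] at this

end Spread
section Dens
set_option linter.unusedSectionVars false
variable {X : Type*} [Fintype X] [DecidableEq X]

open Classical in
lemma two_mul_edges_le (H : SimpleGraph X) (C : Finset X) :
    2 * (Finset.univ.filter fun e : Sym2 X => e ∈ H.edgeSet ∧ ∀ x ∈ e, x ∈ C).card ≤
      ((C ×ˢ C).filter fun z => H.Adj z.1 z.2).card := by
  set Ed := Finset.univ.filter fun e : Sym2 X => e ∈ H.edgeSet ∧ ∀ x ∈ e, x ∈ C
  set P := (C ×ˢ C).filter fun z => H.Adj z.1 z.2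
  have hmap : ∀ z ∈ P, s(z.1, z.2) ∈ Ed := by
    intro z hz
    simp only [P, Finset.mem_filter, Finset.mem_product] at hz
    simp only [Ed, Finset.mem_filter, Finset.mem_univ, true_and]
    refine ⟨hz.2, ?_⟩
    intro x hx
    rw [Sym2.mem_iff] at hx
    rcases hx with rfl | rfl
    · exact hz.1.1
    · exact hz.1.2
  rw [Finset.card_eq_sum_card_fiberwise (f := fun z : X × X => s(z.1, z.2)) (t := Ed) hmap,
    mul_comm, ← smul_eq_mul]
  apply Finset.card_nsmul_le_sum
  intro e he
  induction e with
  | h a b =>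
    simp only [Ed, Finset.mem_filter, Finset.mem_univ, true_and, SimpleGraph.mem_edgeSet] at he
    have ha : a ∈ C := he.2 a (by simp)
    have hb : b ∈ C := he.2 b (by simp)
    have hne : ((a, b) : X × X) ≠ (b, a) := by
      intro h
      exact he.1.ne (Prod.mk.inj h).1
    rw [← Finset.card_pair hne]
    apply Finset.card_le_card
    intro z hz
    simp only [Finset.mem_insert, Finset.mem_singleton] at hz
    simp only [P, Finset.mem_filter, Finset.mem_product]
    rcases hz with rfl | rfl
    · exact ⟨⟨⟨ha, hb⟩, he.1⟩, rfl⟩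
    · exact ⟨⟨⟨hb, ha⟩, he.1.symm⟩, Sym2.eq_swap⟩

open Classical in
lemma pairs_le_deg (H : SimpleGraph X) (C : Finset X) (Δ : ℕ)
    (hdeg : ∀ x, (Finset.univ.filter fun z => H.Adj x z).card ≤ Δ) :
    ((C ×ˢ C).filter fun z => H.Adj z.1 z.2).card ≤ C.card * Δ := by
  rw [Finset.card_filter, Finset.sum_product, ← smul_eq_mul]
  apply Finset.sum_le_card_nsmul
  intro x _
  rw [← Finset.card_filter]
  exact (Finset.card_le_card (Finset.filter_subset_filter _ (Finset.subset_univ C))).trans (hdeg x)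

open Classical in
lemma pairs_le_sq (H : SimpleGraph X) (C : Finset X) :
    ((C ×ˢ C).filter fun z => H.Adj z.1 z.2).card ≤ C.card * C.card - C.card := by
  rw [← Finset.offDiag_card]
  apply Finset.card_le_card
  intro z hz
  simp only [Finset.mem_filter, Finset.mem_product] at hz
  rw [Finset.mem_offDiag]
  exact ⟨hz.1.1, hz.1.2, hz.2.ne⟩

open Classical in
lemma pairs_lt_sq (H : SimpleGraph X) (C : Finset X)
    (h : ∃ u ∈ C, ∃ v ∈ C, u ≠ v ∧ ¬ H.Adj u v) :
    ((C ×ˢ C).filter fun z => H.Adj z.1 z.2).card + 1 ≤ C.card * C.card - C.card := by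
  rw [← Finset.offDiag_card]
  apply Finset.card_lt_card
  rw [Finset.ssubset_iff_of_subset]
  · obtain ⟨u, hu, v, hv, huv, hn⟩ := h
    exact ⟨(u, v), by simp [hu, hv, huv], by simp [hn]⟩
  · intro z hz
    simp only [Finset.mem_filter, Finset.mem_product] at hz
    rw [Finset.mem_offDiag]
    exact ⟨hz.1.1, hz.1.2, hz.2.ne⟩

lemma cast_sq_sub (c : ℕ) : ((c * c - c : ℕ) : ℝ) = (c : ℝ) * (c - 1) := by
  rw [Nat.cast_sub (Nat.le_mul_self c)]
  push_cast
  ring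

open Classical in
lemma dens1 (H : SimpleGraph X) (Δ : ℕ)
    (hdeg : ∀ x, (Finset.univ.filter fun z => H.Adj x z).card ≤ Δ) (C : Finset X)
    (hC : C.Nonempty) :
    ((Finset.univ.filter fun e : Sym2 X => e ∈ H.edgeSet ∧ ∀ x ∈ e, x ∈ C).card : ℝ) ≤
      (((Δ : ℝ) + 1) / 2) * ((C.card : ℝ) - 1) := by
  have h1 := two_mul_edges_le H C
  have h2 : ((2 * (Finset.univ.filter fun e : Sym2 X => e ∈ H.edgeSet ∧ ∀ x ∈ e, x ∈ C).card : ℕ) : ℝ)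
      ≤ ((C.card * Δ : ℕ) : ℝ) := by exact_mod_cast h1.trans (pairs_le_deg H C Δ hdeg)
  have h3 : ((2 * (Finset.univ.filter fun e : Sym2 X => e ∈ H.edgeSet ∧ ∀ x ∈ e, x ∈ C).card : ℕ) : ℝ)
      ≤ ((C.card * C.card - C.card : ℕ) : ℝ) := by exact_mod_cast h1.trans (pairs_le_sq H C)
  rw [cast_sq_sub] at h3
  push_cast at h2 h3
  have hc : (1 : ℝ) ≤ C.card := by exact_mod_cast hC.card_pos
  have hΔ : (0 : ℝ) ≤ Δ := by positivity
  rcases le_total (C.card : ℝ) (Δ + 1) with h | h <;> nlinarith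

open Classical in
lemma dens2 (H : SimpleGraph X) (Δ : ℕ) (hΔ1 : 1 ≤ Δ)
    (hdeg : ∀ x, (Finset.univ.filter fun z => H.Adj x z).card ≤ Δ)
    (hcl : ∀ C : Finset X, C.card = Δ + 1 → ∃ u ∈ C, ∃ v ∈ C, u ≠ v ∧ ¬ H.Adj u v)
    (C : Finset X) (hC : C.Nonempty) :
    ((Finset.univ.filter fun e : Sym2 X => e ∈ H.edgeSet ∧ ∀ x ∈ e, x ∈ C).card : ℝ) ≤
      ((Δ : ℝ) * (Δ + 2) / (2 * (Δ + 1))) * ((C.card : ℝ) - 1) := by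
  have h1 := two_mul_edges_le H C
  have h2 : ((2 * (Finset.univ.filter fun e : Sym2 X => e ∈ H.edgeSet ∧ ∀ x ∈ e, x ∈ C).card : ℕ) : ℝ)
      ≤ ((C.card * Δ : ℕ) : ℝ) := by exact_mod_cast h1.trans (pairs_le_deg H C Δ hdeg)
  have h3 : ((2 * (Finset.univ.filter fun e : Sym2 X => e ∈ H.edgeSet ∧ ∀ x ∈ e, x ∈ C).card : ℕ) : ℝ)
      ≤ ((C.card * C.card - C.card : ℕ) : ℝ) := by exact_mod_cast h1.trans (pairs_le_sq H C)
  have h4 : C.card = Δ + 1 →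
      ((2 * (Finset.univ.filter fun e : Sym2 X => e ∈ H.edgeSet ∧ ∀ x ∈ e, x ∈ C).card + 1 : ℕ) : ℝ)
      ≤ ((C.card * C.card - C.card : ℕ) : ℝ) := by
    intro hc
    exact_mod_cast (Nat.add_le_add_right h1 1).trans (pairs_lt_sq H C (hcl C hc))
  rw [cast_sq_sub] at h3 h4
  set e := (Finset.univ.filter fun e : Sym2 X => e ∈ H.edgeSet ∧ ∀ x ∈ e, x ∈ C).card
  have hc : (1 : ℝ) ≤ C.card := by exact_mod_cast hC.card_pos
  have hΔ : (1 : ℝ) ≤ Δ := by exact_mod_cast hΔ1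
  rw [div_mul_eq_mul_div, le_div_iff₀ (by positivity)]
  push_cast at h2 h3 h4
  rcases lt_trichotomy C.card (Δ + 1) with h | h | h
  · have h' : (C.card : ℝ) ≤ Δ := by exact_mod_cast Nat.lt_succ_iff.1 h
    have : (C.card : ℝ) * (C.card - 1) ≤ Δ * (C.card - 1) := by nlinarith
    nlinarith [mul_nonneg (by linarith : (0:ℝ) ≤ Δ) (by linarith : (0:ℝ) ≤ (C.card:ℝ) - 1)]
  · have h5 := h4 h
    have h' : (C.card : ℝ) = Δ + 1 := by exact_mod_cast h
    rw [h'] at h5 ⊢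
    nlinarith
  · have h' : (Δ : ℝ) + 2 ≤ C.card := by exact_mod_cast h
    nlinarith [mul_nonneg (by linarith : (0:ℝ) ≤ Δ) (by linarith : (0:ℝ) ≤ (C.card:ℝ) - (Δ + 2))]

variable {V : Type*} [Fintype V] [DecidableEq V]

open Classical in
lemma card_edgeImg_le (H : SimpleGraph X) (f : X → V) (Δ : ℕ)
    (hdeg : ∀ x, (Finset.univ.filter fun z => H.Adj x z).card ≤ Δ) :
    (edgeImg H f).card ≤ Δ * Fintype.card X := by
  have h := pairs_le_deg H Finset.univ Δ hdeg
  rw [Finset.card_univ, mul_comm] at h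
  refine le_trans ?_ h
  refine le_trans (Finset.card_le_card (t := Finset.image (fun z : X × X => s(f z.1, f z.2)) _) ?_)
    Finset.card_image_le
  intro e he
  rw [mem_edgeImg] at he
  obtain ⟨u, v, h, rfl⟩ := he
  rw [Finset.mem_image]
  exact ⟨(u, v), by simp [h], rfl⟩

lemma embs_nonempty (Y : Finset V) (h : Fintype.card X ≤ Y.card) : (embs X Y).Nonempty := by
  have : Fintype.card X ≤ Fintype.card Y := by simpa using h
  obtain ⟨g⟩ := Function.Embedding.nonempty_of_card_le this
  refine ⟨fun x => (g x : V), ?_⟩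
  rw [mem_embs]
  exact ⟨fun a b hab => g.injective (Subtype.ext hab), fun x => (g x).2⟩

/-- Disjoint union of `k` cliques of size `r`. -/
def cliques (k r : ℕ) : SimpleGraph (Fin k × Fin r) where
  Adj a b := a.1 = b.1 ∧ a.2 ≠ b.2
  symm := ⟨fun _ _ h => ⟨h.1.symm, h.2.symm⟩⟩
  loopless := ⟨fun _ h => h.2 rfl⟩

open Classical in
lemma cliques_deg (k Δ : ℕ) (x : Fin k × Fin (Δ + 1)) :
    (Finset.univ.filter fun z => (cliques k (Δ + 1)).Adj x z).card ≤ Δ := by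
  have : (Finset.univ.filter fun z => (cliques k (Δ + 1)).Adj x z) ⊆
      (Finset.univ.erase x.2).image (fun a => (x.1, a)) := by
    intro z hz
    have hz' : x.1 = z.1 ∧ x.2 ≠ z.2 := (Finset.mem_filter.1 hz).2
    rw [Finset.mem_image]
    exact ⟨z.2, by simp [hz'.2.symm], by ext <;> simp [hz'.1]⟩
  refine (Finset.card_le_card this).trans (Finset.card_image_le.trans ?_)
  simp

end Dens
section Struct
set_option linter.unusedSectionVars false
variable {X V : Type*} [Fintype X] [DecidableEq X] [Fintype V] [DecidableEq V]

open Classical in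
/-- The (Δ+1)-cliques of `H`. -/
noncomputable def cl (H : SimpleGraph X) (Δ : ℕ) : Finset (Finset X) :=
  Finset.univ.filter fun C => C.card = Δ + 1 ∧ ∀ u ∈ C, ∀ v ∈ C, u ≠ v → H.Adj u v

open Classical in
/-- The closed neighbourhood. -/
noncomputable def cnb (H : SimpleGraph X) (x : X) : Finset X :=
  insert x (Finset.univ.filter fun z => H.Adj x z)

open Classical in
lemma cl_eq_cnb (H : SimpleGraph X) (Δ : ℕ)
    (hdeg : ∀ x, (Finset.univ.filter fun z => H.Adj x z).card ≤ Δ) {C : Finset X}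
    (hC : C ∈ cl H Δ) {x : X} (hx : x ∈ C) : C = cnb H x := by
  simp only [cl, Finset.mem_filter, Finset.mem_univ, true_and] at hC
  apply Finset.eq_of_subset_of_card_le
  · intro z hz
    by_cases h : x = z
    · subst h; exact Finset.mem_insert_self _ _
    · apply Finset.mem_insert_of_mem
      simp [hC.2 x hx z hz h]
  · rw [hC.1]
    refine (Finset.card_insert_le _ _).trans ?_
    exact Nat.add_le_add_right (hdeg x) 1

/-- Vertices in cliques. -/
noncomputable def clV (H : SimpleGraph X) (Δ : ℕ) : Finset X := (cl H Δ).biUnion id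

open Classical in
lemma card_clV (H : SimpleGraph X) (Δ : ℕ)
    (hdeg : ∀ x, (Finset.univ.filter fun z => H.Adj x z).card ≤ Δ) :
    (clV H Δ).card = (cl H Δ).card * (Δ + 1) := by
  unfold clV
  rw [Finset.card_biUnion]
  · rw [Finset.sum_const_nat]
    intro C hC
    simp only [cl, Finset.mem_filter, Finset.mem_univ, true_and] at hC
    exact hC.1
  · intro C hC C' hC' hne
    rw [Function.onFun, Finset.disjoint_left]
    intro x hx hx'
    exact hne ((cl_eq_cnb H Δ hdeg hC hx).trans (cl_eq_cnb H Δ hdeg hC' hx').symm)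

open Classical in
lemma cnb_mem (H : SimpleGraph X) (Δ : ℕ)
    (hdeg : ∀ x, (Finset.univ.filter fun z => H.Adj x z).card ≤ Δ) {x : X} (hx : x ∈ clV H Δ) :
    cnb H x ∈ cl H Δ := by
  simp only [clV, Finset.mem_biUnion, id] at hx
  obtain ⟨C, hC, hxC⟩ := hx
  rwa [← cl_eq_cnb H Δ hdeg hC hxC]

open Classical in
lemma cnb_adj (H : SimpleGraph X) (Δ : ℕ)
    (hdeg : ∀ x, (Finset.univ.filter fun z => H.Adj x z).card ≤ Δ) {x y : X} (hx : x ∈ clV H Δ)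
    (hxy : H.Adj x y) : y ∈ clV H Δ ∧ cnb H x = cnb H y := by
  have h1 := cnb_mem H Δ hdeg hx
  have hy : y ∈ cnb H x := Finset.mem_insert_of_mem (by simp [hxy])
  refine ⟨?_, cl_eq_cnb H Δ hdeg h1 hy⟩
  simp only [clV, Finset.mem_biUnion, id]
  exact ⟨_, h1, hy⟩

open Classical in
lemma clique_embed (H : SimpleGraph X) (Δ : ℕ)
    (hdeg : ∀ x, (Finset.univ.filter fun z => H.Adj x z).card ≤ Δ)
    {k : ℕ} (f : Fin k × Fin (Δ + 1) → V) (hf : Function.Injective f) (W : Finset (Sym2 V))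
    (G : Finset (Fin k)) (hG : ∀ i ∈ G, ∀ a b, a ≠ b → s(f (i, a), f (i, b)) ∈ W)
    (hGc : (cl H Δ).card ≤ G.card) :
    ∃ c : clV H Δ → V, Function.Injective c ∧ ∀ x y : clV H Δ, H.Adj x y → s(c x, c y) ∈ W := by
  have hle : Fintype.card (cl H Δ) ≤ Fintype.card G := by simpa using hGc
  obtain ⟨ι⟩ := Function.Embedding.nonempty_of_card_le hle
  have hcard : ∀ C : cl H Δ, (C : Finset X).card = Δ + 1 := by
    intro C
    have := C.2
    simp only [cl, Finset.mem_filter, Finset.mem_univ, true_and] at this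
    exact this.1
  let e : ∀ C : cl H Δ, (C : Finset X) ≃ Fin (Δ + 1) := fun C => Finset.equivFinOfCardEq (hcard C)
  let Cx : clV H Δ → cl H Δ := fun x => ⟨cnb H x, cnb_mem H Δ hdeg x.2⟩
  let j : cl H Δ → X → Fin (Δ + 1) := fun C x => if h : x ∈ (C : Finset X) then e C ⟨x, h⟩ else 0
  have hj : ∀ (C : cl H Δ) (x y : X), x ∈ (C : Finset X) → y ∈ (C : Finset X) → j C x = j C y → x = y := by
    intro C x y hx hy hxy
    simp only [j, dif_pos hx, dif_pos hy] at hxy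
    simpa using (e C).injective hxy
  have hself : ∀ x : X, x ∈ cnb H x := fun x => Finset.mem_insert_self _ _
  refine ⟨fun x => f (ι (Cx x), j (Cx x) x), ?_, ?_⟩
  · intro x y hxy
    have h1 := hf hxy
    rw [Prod.mk.injEq] at h1
    have h2 : Cx x = Cx y := ι.injective (Subtype.ext h1.1)
    have h3 := h1.2
    rw [h2] at h3
    apply Subtype.ext
    refine hj (Cx y) x y ?_ (hself _) h3
    rw [← h2]
    exact hself _
  · intro x y hxy
    have h2 : Cx x = Cx y := Subtype.ext (cnb_adj H Δ hdeg x.2 hxy).2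
    beta_reduce
    rw [← h2]
    apply hG _ (ι (Cx x)).2
    intro h
    refine hxy.ne (hj (Cx x) x y (hself _) ?_ h)
    rw [h2]
    exact hself _

/-- `W` contains a copy of `H`. -/
def copyIn (H : SimpleGraph X) (W : Finset (Sym2 V)) : Prop :=
  ∃ f : X → V, Function.Injective f ∧ ∀ u v, H.Adj u v → s(f u, f v) ∈ W

open Classical in
/-- The failure indicator. -/
noncomputable def failH (H : SimpleGraph X) (W : Finset (Sym2 V)) : ℝ := if copyIn H W then 0 else 1

lemma failH_le_one (H : SimpleGraph X) (W : Finset (Sym2 V)) : failH H W ≤ 1 := by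
  unfold failH; split_ifs <;> norm_num

lemma failH_anti (H : SimpleGraph X) (W W' : Finset (Sym2 V)) (h : W ⊆ W') :
    failH H W' ≤ failH H W := by
  unfold failH
  by_cases h1 : copyIn H W
  · have h2 : copyIn H W' := by
      obtain ⟨f, hf, hs⟩ := h1
      exact ⟨f, hf, fun u v huv => h (hs u v huv)⟩
    rw [if_pos h1, if_pos h2]
  · rw [if_neg h1]
    split_ifs <;> norm_num

open Classical in
lemma glue (H : SimpleGraph X) (Δ : ℕ)
    (hdeg : ∀ x, (Finset.univ.filter fun z => H.Adj x z).card ≤ Δ) (W W₂ : Finset (Sym2 V))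
    (c : clV H Δ → V) (hc : Function.Injective c)
    (hcW : ∀ x y : clV H Δ, H.Adj x y → s(c x, c y) ∈ W)
    (g : {x // x ∉ clV H Δ} → V) (hg : g ∈ embs {x // x ∉ clV H Δ} (Finset.univ \ Finset.univ.image c))
    (hgW : edgeImg (H.comap Subtype.val) g ⊆ W₂) : copyIn H (W ∪ W₂) := by
  rw [mem_embs] at hg
  obtain ⟨hginj, hgY⟩ := hg
  have hcg : ∀ x y, c x ≠ g y := by
    intro x y h
    have := hgY y
    rw [Finset.mem_sdiff] at this
    exact this.2 (Finset.mem_image.2 ⟨x, Finset.mem_univ _, h⟩)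
  refine ⟨fun x => if h : x ∈ clV H Δ then c ⟨x, h⟩ else g ⟨x, h⟩, ?_, ?_⟩
  · intro x y hxy
    by_cases hx : x ∈ clV H Δ <;> by_cases hy : y ∈ clV H Δ
    · simp only [dif_pos hx, dif_pos hy] at hxy
      simpa using hc hxy
    · simp only [dif_pos hx, dif_neg hy] at hxy
      exact absurd hxy (hcg _ _)
    · simp only [dif_neg hx, dif_pos hy] at hxy
      exact absurd hxy.symm (hcg _ _)
    · simp only [dif_neg hx, dif_neg hy] at hxy
      simpa using hginj hxy
  · intro x y hxy
    by_cases hx : x ∈ clV H Δ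
    · have hy := (cnb_adj H Δ hdeg hx hxy).1
      simp only [dif_pos hx, dif_pos hy]
      exact Finset.mem_union_left _ (hcW ⟨x, hx⟩ ⟨y, hy⟩ hxy)
    · have hy : y ∉ clV H Δ := fun hy => hx (cnb_adj H Δ hdeg hy hxy.symm).1
      simp only [dif_neg hx, dif_neg hy]
      apply Finset.mem_union_right
      apply hgW
      rw [pair_mem_edgeImg]
      exact ⟨⟨x, hx⟩, ⟨y, hy⟩, hxy, rfl, rfl⟩

open Classical in
lemma good_count {k Δ : ℕ} (f : Fin k × Fin (Δ + 1) → V) (hf : Function.Injective f)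
    (W : Finset (Sym2 V)) :
    k ≤ (Finset.univ.filter fun i : Fin k => ∀ a b, a ≠ b → s(f (i, a), f (i, b)) ∈ W).card +
      (edgeImg (cliques k (Δ + 1)) f \ W).card := by
  have h := Finset.card_filter_add_card_filter_not (s := (Finset.univ : Finset (Fin k)))
    (fun i : Fin k => ∀ a b, a ≠ b → s(f (i, a), f (i, b)) ∈ W)
  rw [Finset.card_univ, Fintype.card_fin] at h
  have h2 : (Finset.univ.filter fun i : Fin k => ¬ ∀ a b, a ≠ b → s(f (i, a), f (i, b)) ∈ W).card ≤
      (edgeImg (cliques k (Δ + 1)) f \ W).card := by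
    have hex : ∀ i : Fin k, ∃ ab : Fin (Δ + 1) × Fin (Δ + 1),
        (¬ ∀ a b, a ≠ b → s(f (i, a), f (i, b)) ∈ W) →
          ab.1 ≠ ab.2 ∧ s(f (i, ab.1), f (i, ab.2)) ∉ W := by
      intro i
      by_cases h : ∀ a b, a ≠ b → s(f (i, a), f (i, b)) ∈ W
      · exact ⟨(0, 0), fun h' => absurd h h'⟩
      · push Not at h
        obtain ⟨a, b, h1, h2⟩ := h
        exact ⟨(a, b), fun _ => ⟨h1, h2⟩⟩
    choose ab hab using hex
    apply Finset.card_le_card_of_injOn (fun i => s(f (i, (ab i).1), f (i, (ab i).2)))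
    · intro i hi
      have hi' := hab i (Finset.mem_filter.1 hi).2
      rw [Finset.mem_coe, Finset.mem_sdiff, mem_edgeImg]
      exact ⟨⟨(i, (ab i).1), (i, (ab i).2), ⟨rfl, hi'.1⟩, rfl⟩, hi'.2⟩
    · intro i _ i' _ h
      simp only [Sym2.eq_iff] at h
      rcases h with ⟨h, _⟩ | ⟨h, _⟩
      · exact (Prod.mk.inj (hf h)).1
      · exact (Prod.mk.inj (hf h)).1
  omega

open Classical in
theorem fixed (H : SimpleGraph X) (Δ : ℕ) (hΔ : 1 ≤ Δ)
    (hdeg : ∀ x, (Finset.univ.filter fun z => H.Adj x z).card ≤ Δ)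
    (N t : ℕ) (hN0 : 0 < N)
    (hX : Fintype.card X + t * (Δ + 1) + N ≤ Fintype.card V)
    {R q₁ q₂ p₁ p₂ b y : ℝ} (hR1 : 1 ≤ R) (hR : (Fintype.card V : ℝ) ≤ R * N)
    (hq10 : 0 < q₁) (hq11 : q₁ ≤ 1) (hq1 : R * (Δ / N) ≤ q₁ ^ (((Δ : ℝ) + 1) / 2))
    (hq20 : 0 < q₂) (hq21 : q₂ ≤ 1) (hq2 : R * (Δ / N) ≤ q₂ ^ ((Δ : ℝ) * (Δ + 2) / (2 * (Δ + 1))))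
    (hp10 : 0 < p₁) (hp11 : p₁ ≤ 1) (hp20 : 0 < p₂) (hp21 : p₂ ≤ 1)
    (h1 : 8 * (q₁ / p₁) * (Δ * Fintype.card V) ≤ t)
    (h2 : 8 * (q₂ / p₂) ≤ 1) (hb : 0 ≤ b) (hy0 : 0 < y) (hy1 : y ≤ 1) (hby : q₂ / p₂ * b ≤ y) (K : ℕ)
    (hK : (8 * (q₂ / p₂)) ^ K * (Δ * Fintype.card V) ≤ b) :
    pr (p₁ + (1 - (1 - p₂) ^ (K + 1)) - p₁ * (1 - (1 - p₂) ^ (K + 1))) (failH (V := V) H) ≤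
      Real.exp (-t) + (3 * y + K * Real.exp (-b)) := by
  set pp := 1 - (1 - p₂) ^ (K + 1) with hpp
  have hpp0 : 0 ≤ pp := by
    have := pow_le_one₀ (n := K + 1) (by linarith : 0 ≤ 1 - p₂) (by linarith)
    linarith
  have hpp1 : pp ≤ 1 := by
    have := pow_nonneg (by linarith : 0 ≤ 1 - p₂) (K + 1)
    linarith
  have hΔ0 : (0 : ℝ) ≤ Δ := by positivity
  set k := (cl H Δ).card with hk
  have hkX : k * (Δ + 1) ≤ Fintype.card X := by
    rw [hk, ← card_clV H Δ hdeg]; exact Finset.card_le_univ _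
  -- stage 1
  let X1 := Fin (k + t) × Fin (Δ + 1)
  have hX1c : Fintype.card X1 = (k + t) * (Δ + 1) := by simp [X1]
  let J1 : Finset (X1 → V) := embs X1 Finset.univ
  let S1 : (X1 → V) → Finset (Sym2 V) := edgeImg (cliques (k + t) (Δ + 1))
  have hX1N : Fintype.card X1 + N ≤ (Finset.univ : Finset V).card := by
    rw [hX1c, Finset.card_univ, add_mul]; omega
  have hX1V : (Fintype.card X1 : ℝ) ≤ Fintype.card V := by
    rw [Finset.card_univ] at hX1N
    exact_mod_cast (by omega : Fintype.card X1 ≤ Fintype.card V)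
  obtain ⟨c, hc, hbd⟩ := frag (E := Sym2 V) hp10 hp11 hq10.le (M := (J1.card : ℝ)) (by positivity)
    (ℓ := Δ * Fintype.card V) (by positivity) J1 S1
    (spread (cliques (k + t) (Δ + 1)) Finset.univ N Δ hN0 hX1N (cliques_deg (k + t) Δ) hR1
      (hX1V.trans hR) hq10 hq11 hq1
      (dens1 _ Δ (cliques_deg (k + t) Δ))) (by
      intro f _
      have : ((S1 f).card : ℝ) ≤ Δ * Fintype.card X1 := by
        exact_mod_cast card_edgeImg_le _ f Δ (cliques_deg (k + t) Δ)
      refine this.trans ?_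
      gcongr)
  have hbad := hbd 2 t (by norm_num)
  have hJ1pos : 0 < (J1.card : ℝ) := by
    have := embs_nonempty (X := X1) (Finset.univ : Finset V) (by omega)
    exact_mod_cast this.card_pos
  have hbad' : pr p₁ (fun W => ((J1.filter fun i => (t : ℝ) ≤ ((S1 (c W i) \ W).card : ℝ)).card : ℝ)) ≤
      J1.card * Real.exp (-t) := by
    refine hbad.trans ?_
    apply mul_le_mul_of_nonneg_left _ hJ1pos.le
    rw [← Real.exp_add]
    apply Real.exp_le_exp.2
    have : Real.exp 2 * (q₁ / p₁) * (Δ * Fintype.card V) ≤ 8 * (q₁ / p₁) * (Δ * Fintype.card V) := by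
      have := exp_two_le
      gcongr
    linarith
  let Gd : Finset (Sym2 V) → Prop := fun W => ∃ f ∈ J1, ((S1 f \ W).card : ℝ) < t
  have hP1 : pr p₁ (fun W => if Gd W then (0:ℝ) else 1) ≤ Real.exp (-t) := by
    have h3 : pr p₁ (fun W => if Gd W then (0:ℝ) else 1) * J1.card ≤ J1.card * Real.exp (-t) := by
      refine le_trans ?_ hbad'
      rw [← pr_mul_right]
      apply pr_mono hp10.le hp11
      intro W
      beta_reduce
      split_ifs with h
      · simp
      · rw [one_mul]
        have : (J1.filter fun i => (t : ℝ) ≤ ((S1 (c W i) \ W).card : ℝ)) = J1 := by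
          apply Finset.filter_true_of_mem
          intro i hi
          by_contra h'
          exact h ⟨c W i, (hc W i hi).1, not_le.1 h'⟩
        rw [this]
    rw [mul_comm] at h3
    exact le_of_mul_le_mul_left h3 hJ1pos
  -- stage 2
  have hstage2 : ∀ W, Gd W → pr pp (fun W₂ => failH H (W ∪ W₂)) ≤ 3 * y + K * Real.exp (-b) := by
    rintro W ⟨f, hf, hft⟩
    have hfi : Function.Injective f := (mem_embs.1 hf).1
    have hcount := good_count f hfi W
    have hft' : (S1 f \ W).card < t := by exact_mod_cast hft
    obtain ⟨c, hci, hcW⟩ := clique_embed H Δ hdeg f hfi W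
      (Finset.univ.filter fun i : Fin (k+t) => ∀ a b, a ≠ b → s(f (i,a), f (i,b)) ∈ W)
      (fun i hi => (Finset.mem_filter.1 hi).2) (by
        have : (edgeImg (cliques (k + t) (Δ + 1)) f \ W).card < t := hft'
        omega)
    let X2 := {x // x ∉ clV H Δ}
    let H2 : SimpleGraph X2 := H.comap Subtype.val
    let Y : Finset V := Finset.univ \ Finset.univ.image c
    have hYc : Y.card + (clV H Δ).card = Fintype.card V := by
      have h5 : (Finset.univ.image c).card = (clV H Δ).card := by
        rw [Finset.card_image_of_injective _ hci, Finset.card_univ, Fintype.card_coe]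
      rw [← h5, ← Finset.card_univ]
      exact Finset.card_sdiff_add_card_eq_card (Finset.subset_univ _)
    have hX2c : Fintype.card X2 + (clV H Δ).card = Fintype.card X := by
      have h6 := Fintype.card_subtype_compl (fun x => x ∈ clV H Δ)
      have h7 : Fintype.card {x // x ∈ clV H Δ} = (clV H Δ).card := Fintype.card_coe _
      have h8 : (clV H Δ).card ≤ Fintype.card X := Finset.card_le_univ _
      have h9 : Fintype.card X2 = Fintype.card {x // ¬ x ∈ clV H Δ} := rfl
      omega
    have hdeg2 : ∀ x : X2, (Finset.univ.filter fun z => H2.Adj x z).card ≤ Δ := by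
      intro x
      refine le_trans ?_ (hdeg x)
      apply Finset.card_le_card_of_injOn Subtype.val
      · intro z hz
        have := (Finset.mem_filter.1 hz).2
        exact Finset.mem_filter.2 ⟨Finset.mem_univ _, this⟩
      · intro _ _ _ _ h
        exact Subtype.ext h
    have hcl2 : ∀ C : Finset X2, C.card = Δ + 1 → ∃ u ∈ C, ∃ v ∈ C, u ≠ v ∧ ¬ H2.Adj u v := by
      intro C hC
      by_contra hcon
      push Not at hcon
      have hmem : C.map (Function.Embedding.subtype _) ∈ cl H Δ := by
        simp only [cl, Finset.mem_filter, Finset.mem_univ, true_and, Finset.card_map]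
        refine ⟨hC, ?_⟩
        intro u hu v hv huv
        rw [Finset.mem_map] at hu hv
        obtain ⟨u, hu, rfl⟩ := hu
        obtain ⟨v, hv, rfl⟩ := hv
        exact hcon u hu v hv (fun h => huv (by rw [h]))
      obtain ⟨u, hu⟩ : C.Nonempty := Finset.card_pos.1 (by omega)
      apply u.2
      simp only [clV, Finset.mem_biUnion, id]
      exact ⟨_, hmem, Finset.mem_map.2 ⟨u, hu, rfl⟩⟩
    have hX2V : (Fintype.card X2 : ℝ) ≤ Fintype.card V := by
      exact_mod_cast (by omega : Fintype.card X2 ≤ Fintype.card V)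
    have hJ2 := embs_nonempty (X := X2) Y (by omega)
    have hJ2pos : (0 : ℝ) < (embs X2 Y).card := by exact_mod_cast hJ2.card_pos
    have hit := iter (E := Sym2 V) hp20 hp21 hq20.le (M := ((embs X2 Y).card : ℝ)) hJ2pos.le h2 hb hy0
      hy1 hby K (Δ * Fintype.card V) (by positivity) (embs X2 Y) (edgeImg H2)
      (spread H2 Y N Δ hN0 (by omega) hdeg2 hR1 (hX2V.trans hR) hq20 hq21 hq2
        (dens2 H2 Δ hΔ hdeg2 hcl2)) (by
        intro f _
        have : ((edgeImg H2 f).card : ℝ) ≤ Δ * Fintype.card X2 := by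
          exact_mod_cast card_edgeImg_le _ f Δ hdeg2
        refine this.trans ?_
        gcongr) hK
    rw [mul_comm] at hit
    refine le_trans ?_ (le_of_mul_le_mul_left hit hJ2pos)
    apply pr_mono hpp0 hpp1
    intro W₂
    unfold failInd
    split_ifs with h
    · obtain ⟨g, hg, hgW⟩ := h
      have := glue H Δ hdeg W W₂ c hci hcW g hg hgW
      unfold failH
      rw [if_pos this]
    · exact failH_le_one _ _
  rw [← pr_union]
  have hδ : 0 ≤ 3 * y + K * Real.exp (-b) := by positivity
  calc _ ≤ pr p₁ (fun W => (if Gd W then (0:ℝ) else 1) + (3 * y + K * Real.exp (-b))) := by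
        apply pr_mono hp10.le hp11
        intro W
        beta_reduce
        by_cases h : Gd W
        · rw [if_pos h, zero_add]
          exact hstage2 W h
        · rw [if_neg h]
          have : pr pp (fun W₂ => failH H (W ∪ W₂)) ≤ 1 :=
            (pr_mono hpp0 hpp1 (G := fun _ => (1:ℝ)) fun W₂ => failH_le_one _ _).trans
              (le_of_eq (pr_const _ _))
          linarith
    _ = _ := by rw [pr_add, pr_const]
    _ ≤ _ := by linarith

end Struct
lemma bern_singleton {p : ℝ} (h0 : 0 ≤ p) (h1 : p ≤ 1) (x : Bool) :
    bernoulliMeasure p {x} = ENNReal.ofReal (if x = true then p else 1 - p) := by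
  have hm : min (ENNReal.ofReal p) 1 = ENNReal.ofReal p :=
    min_eq_left (ENNReal.ofReal_le_one.2 h1)
  unfold bernoulliMeasure
  rw [hm]
  cases x
  · simp [ENNReal.ofReal_sub _ h0]
  · simp

lemma bern_prob {p : ℝ} : IsProbabilityMeasure (bernoulliMeasure p) := by
  constructor
  unfold bernoulliMeasure
  simp

lemma gnp_prob (n : ℕ) (p : ℝ) : IsProbabilityMeasure (gnp n p) := by
  unfold gnp
  have : IsProbabilityMeasure (bernoulliMeasure p) := bern_prob
  infer_instance

lemma gnp_singleton (n : ℕ) {p : ℝ} (h0 : 0 ≤ p) (h1 : p ≤ 1) (ω : Sym2 (Fin n) → Bool) :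
    gnp n p {ω} = ENNReal.ofReal (∏ e, if ω e = true then p else 1 - p) := by
  unfold gnp
  have : IsProbabilityMeasure (bernoulliMeasure p) := bern_prob
  rw [Measure.pi_singleton, ENNReal.ofReal_prod_of_nonneg]
  · exact Finset.prod_congr rfl fun e _ => bern_singleton h0 h1 _
  · intro e _
    split_ifs <;> linarith

lemma copyIn_contains {X : Type*} {n : ℕ} (H : SimpleGraph X) (ω : Sym2 (Fin n) → Bool)
    (h : copyIn H (finsetBool.symm ω)) : ContainsCopy H (graphOf ω) := by
  obtain ⟨f, hf, hs⟩ := h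
  refine ⟨f, hf, fun u v huv => ?_⟩
  unfold graphOf
  rw [SimpleGraph.fromRel_adj]
  refine ⟨fun h => huv.ne (hf h), Or.inl ?_⟩
  have := hs u v huv
  simpa [finsetBool] using this

open Classical in
lemma link {X : Type*} [Fintype X] [DecidableEq X] (n : ℕ) (H : SimpleGraph X) {p : ℝ} (h0 : 0 ≤ p) (h1 : p ≤ 1) :
    ENNReal.ofReal (1 - pr p (failH (V := Fin n) H)) ≤
      gnp n p {ω | ContainsCopy H (graphOf ω)} := by
  set S : Finset (Sym2 (Fin n) → Bool) := Finset.univ.filter fun ω => ContainsCopy H (graphOf ω) with hS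
  have hSS : {ω : Sym2 (Fin n) → Bool | ContainsCopy H (graphOf ω)} = ↑S := by
    ext ω; simp [hS]
  have hw : ∀ ω : Sym2 (Fin n) → Bool, 0 ≤ ∏ e, if ω e = true then p else 1 - p := by
    intro ω
    apply Finset.prod_nonneg
    intro e _
    split_ifs <;> linarith
  rw [hSS, ← sum_measure_singleton]
  simp only [gnp_singleton n h0 h1]
  rw [← ENNReal.ofReal_sum_of_nonneg (fun ω _ => hw ω)]
  apply ENNReal.ofReal_le_ofReal
  have he : 1 - pr p (failH (V := Fin n) H) =
      pr p (fun _ : Finset (Sym2 (Fin n)) => (1 : ℝ)) - pr p (failH (V := Fin n) H) := by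
    rw [pr_const]
  rw [he, pr_eq_bool, pr_eq_bool, ← Finset.sum_sub_distrib, hS,
    Finset.sum_filter]
  apply Finset.sum_le_sum
  intro ω _
  split_ifs with h
  · have : 0 ≤ failH (V := Fin n) H (finsetBool.symm ω) := by
      unfold failH; split_ifs <;> norm_num
    nlinarith [mul_nonneg (hw ω) this]
  · have : failH (V := Fin n) H (finsetBool.symm ω) = 1 := by
      unfold failH
      rw [if_neg]
      exact fun h' => h (copyIn_contains H ω h')
    rw [this]
    linarith

open Classical in
lemma deg_of_maxDeg {X : Type*} [Fintype X] (H : SimpleGraph X) (Δ : ℕ) (h : maxDeg H ≤ Δ) (x : X) :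
    (Finset.univ.filter fun z => H.Adj x z).card ≤ Δ := by
  unfold maxDeg at h
  have h1 := (Finset.le_sup (f := fun v => (H.neighborSet v).ncard) (Finset.mem_univ x)).trans h
  refine le_trans (le_of_eq ?_) h1
  rw [← Set.ncard_coe_finset]
  congr 1
  ext z
  simp

set_option maxHeartbeats 1600000 in
open Classical in
lemma main_n (Δ : ℕ) (hΔ : 1 ≤ Δ) {ε : ℝ} (hε : 0 < ε) (hε1 : ε ≤ 1) {X : Type*} [Fintype X]
    [DecidableEq X] (H : SimpleGraph X)
    (hdeg : ∀ x, (Finset.univ.filter fun z => H.Adj x z).card ≤ Δ) (n : ℕ)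
    (hX : (Fintype.card X : ℝ) ≤ (1 - ε) * n) {P : ℝ} (hP1 : P ≤ 1) (K : ℕ)
    {γ κ a c₂ : ℝ} (ha : a = 2 / ((Δ : ℝ) + 1)) (hc₂ : c₂ = 2 * ((Δ : ℝ) + 1) / (Δ * (Δ + 2)))
    (hγ : γ = c₂ - a) (hγ0 : 0 < γ) (hK : 2 ≤ γ * K)
    (hκ : κ = 16 * Δ / ε ^ 2)
    (E1 : 4 * ((Δ : ℝ) + 1) / ε ≤ n) (E2 : κ ≤ n)
    (E3 : 64 * κ ^ a * Δ * (Δ + 1) / ε ≤ P * (n : ℝ) ^ a) (E3' : 1 ≤ P * (n : ℝ) ^ a)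
    (E4 : 16 * (K + 1) * κ ^ c₂ ≤ (n : ℝ) ^ (γ / 2)) (E5 : (Δ : ℝ) ≤ (n : ℝ) ^ (γ / 4)) :
    pr P (failH (V := Fin n) H) ≤ Real.exp (-(⌊ε * n / (2 * ((Δ : ℝ) + 1))⌋₊ : ℝ)) +
      (3 * (n : ℝ) ^ (-(γ / 4)) + K * Real.exp (-(n : ℝ) ^ (γ / 4))) := by
  have hΔr : (1 : ℝ) ≤ Δ := by exact_mod_cast hΔ
  have hn4 : 4 * ((Δ : ℝ) + 1) ≤ ε * n := by
    rw [div_le_iff₀ hε] at E1; linarith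
  have hn1 : (1 : ℝ) ≤ n := by nlinarith
  have hn0 : (0 : ℝ) < n := by linarith
  have hκ0 : 0 < κ := by rw [hκ]; positivity
  have hna : 0 < (n : ℝ) ^ a := Real.rpow_pos_of_pos hn0 _
  have hP0 : 0 < P := by
    by_contra h
    have : P * (n : ℝ) ^ a ≤ 0 := mul_nonpos_of_nonpos_of_nonneg (not_lt.1 h) hna.le
    linarith
  set t := ⌊ε * n / (2 * ((Δ : ℝ) + 1))⌋₊ with ht
  set N := ⌊ε * n / 2⌋₊ with hN
  have ht1 : (t : ℝ) ≤ ε * n / (2 * ((Δ : ℝ) + 1)) := Nat.floor_le (by positivity)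
  have hN1 : (N : ℝ) ≤ ε * n / 2 := Nat.floor_le (by positivity)
  have ht2 : ε * n / (4 * ((Δ : ℝ) + 1)) ≤ t := by
    have h1 := Nat.lt_floor_add_one (ε * n / (2 * ((Δ : ℝ) + 1)))
    have h2 : 1 ≤ ε * n / (4 * ((Δ : ℝ) + 1)) := by
      rw [le_div_iff₀ (by positivity)]; linarith
    have h3 : ε * n / (2 * ((Δ : ℝ) + 1)) = 2 * (ε * n / (4 * ((Δ : ℝ) + 1))) := by
      field_simp; ring
    rw [← ht] at h1
    linarith
  have hN2 : ε * n / 4 ≤ N := by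
    have h1 := Nat.lt_floor_add_one (ε * n / 2)
    rw [← hN] at h1
    linarith
  have hNr : (0 : ℝ) < N := by nlinarith
  have hN0 : 0 < N := by exact_mod_cast hNr
  have hc0 : 0 < c₂ := by rw [hc₂]; positivity
  have ha0 : 0 < a := by rw [ha]; positivity
  have hκn : κ / n ≤ 1 := by rw [div_le_one hn0]; exact E2
  have hκn0 : 0 < κ / n := by positivity
  have hRκ : 4 / ε * (Δ / N) ≤ κ / n := by
    calc 4 / ε * (Δ / N) ≤ 4 / ε * (Δ / (ε * n / 4)) := by gcongr
      _ = κ / n := by rw [hκ]; field_simp; ring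
  have hK0 : (0 : ℝ) ≤ K := by positivity
  have hq2n : (κ / n) ^ c₂ = κ ^ c₂ * ((n : ℝ) ^ c₂)⁻¹ := by
    rw [Real.div_rpow hκ0.le hn0.le, div_eq_mul_inv]
  have hq1n : (κ / n) ^ a = κ ^ a * ((n : ℝ) ^ a)⁻¹ := by
    rw [Real.div_rpow hκ0.le hn0.le, div_eq_mul_inv]
  have hκa : 0 < κ ^ a := Real.rpow_pos_of_pos hκ0 _
  have hκc : 0 < κ ^ c₂ := Real.rpow_pos_of_pos hκ0 _
  have hr : 8 * ((κ / n) ^ c₂ / (P / (2 * (K + 1)))) ≤ (n : ℝ) ^ (-(γ / 2)) := by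
    have e1 : (n : ℝ) ^ c₂ = (n : ℝ) ^ a * ((n : ℝ) ^ (γ / 2) * (n : ℝ) ^ (γ / 2)) := by
      rw [← Real.rpow_add hn0, ← Real.rpow_add hn0]; congr 1; rw [hγ]; ring
    have hg : 0 < (n : ℝ) ^ (γ / 2) := Real.rpow_pos_of_pos hn0 _
    rw [hq2n, e1, Real.rpow_neg hn0.le]
    have e2 : 8 * (κ ^ c₂ * ((n : ℝ) ^ a * ((n : ℝ) ^ (γ / 2) * (n : ℝ) ^ (γ / 2)))⁻¹ / (P / (2 * (K + 1))))
        = (16 * (K + 1) * κ ^ c₂) / ((P * (n : ℝ) ^ a) * ((n : ℝ) ^ (γ / 2) * (n : ℝ) ^ (γ / 2))) := by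
      field_simp; ring
    rw [e2, div_le_iff₀ (by positivity)]
    have e3 : ((n : ℝ) ^ (γ / 2))⁻¹ * (P * (n : ℝ) ^ a * ((n : ℝ) ^ (γ / 2) * (n : ℝ) ^ (γ / 2))) =
        (P * (n : ℝ) ^ a) * (n : ℝ) ^ (γ / 2) := by
      field_simp
    rw [e3]
    nlinarith
  have hr0 : 0 ≤ (κ / n) ^ c₂ / (P / (2 * (K + 1))) := by positivity
  have hstage1 : 8 * ((κ / n) ^ a / (P / 2)) * (Δ * Fintype.card (Fin n)) ≤ t := by
    refine le_trans ?_ ht2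
    rw [Fintype.card_fin, hq1n]
    have e2 : 8 * (κ ^ a * ((n : ℝ) ^ a)⁻¹ / (P / 2)) * (Δ * n) =
        16 * κ ^ a * Δ * n / (P * (n : ℝ) ^ a) := by
      field_simp; ring
    rw [e2, div_le_div_iff₀ (by positivity) (by positivity)]
    rw [div_le_iff₀ hε] at E3
    have := mul_le_mul_of_nonneg_right E3 hn0.le
    calc 16 * κ ^ a * Δ * n * (4 * ((Δ : ℝ) + 1)) = 64 * κ ^ a * Δ * (Δ + 1) * n := by ring
      _ ≤ P * (n : ℝ) ^ a * ε * n := this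
      _ = _ := by ring
  have hfix := fixed (V := Fin n) H Δ hΔ hdeg N t hN0 (by
      rw [Fintype.card_fin]
      have h5 : (t : ℝ) * (Δ + 1) ≤ ε * n / 2 := by
        calc (t : ℝ) * (Δ + 1) ≤ ε * n / (2 * ((Δ : ℝ) + 1)) * (Δ + 1) := by gcongr
          _ = _ := by field_simp
      have h6 : (Fintype.card X : ℝ) + t * (Δ + 1) + N ≤ n := by linarith
      exact_mod_cast h6)
    (R := 4 / ε) (q₁ := (κ / n) ^ a) (q₂ := (κ / n) ^ c₂) (p₁ := P / 2) (p₂ := P / (2 * (K + 1)))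
    (b := (n : ℝ) ^ (γ / 4)) (y := (n : ℝ) ^ (-(γ / 4)))
    (by rw [le_div_iff₀ hε]; linarith)
    (by
      rw [Fintype.card_fin]
      calc (n : ℝ) = 4 / ε * (ε * n / 4) := by field_simp
        _ ≤ _ := by gcongr)
    (Real.rpow_pos_of_pos hκn0 _) (Real.rpow_le_one hκn0.le hκn ha0.le)
    (by
      rw [← Real.rpow_mul hκn0.le]
      have : a * (((Δ : ℝ) + 1) / 2) = 1 := by rw [ha]; field_simp
      rw [this, Real.rpow_one]
      exact hRκ)
    (Real.rpow_pos_of_pos hκn0 _) (Real.rpow_le_one hκn0.le hκn hc0.le)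
    (by
      rw [← Real.rpow_mul hκn0.le]
      have : c₂ * ((Δ : ℝ) * (Δ + 2) / (2 * (Δ + 1))) = 1 := by rw [hc₂]; field_simp
      rw [this, Real.rpow_one]
      exact hRκ)
    (by positivity) (by linarith) (by positivity)
    (by rw [div_le_one (by positivity)]; nlinarith)
    hstage1
    (hr.trans (Real.rpow_le_one_of_one_le_of_nonpos hn1 (by linarith)))
    (by positivity) (by positivity)
    (Real.rpow_le_one_of_one_le_of_nonpos hn1 (by linarith))
    (by
      have h7 : (κ / n) ^ c₂ / (P / (2 * (K + 1))) ≤ (n : ℝ) ^ (-(γ / 2)) := by linarith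
      calc _ ≤ (n : ℝ) ^ (-(γ / 2)) * (n : ℝ) ^ (γ / 4) := by gcongr
        _ = _ := by rw [← Real.rpow_add hn0]; congr 1; ring)
    K
    (by
      rw [Fintype.card_fin]
      have h8 : (8 * ((κ / n) ^ c₂ / (P / (2 * (K + 1))))) ^ K ≤ (n : ℝ)⁻¹ := by
        calc _ ≤ ((n : ℝ) ^ (-(γ / 2))) ^ K := by gcongr
          _ = (n : ℝ) ^ (-(γ / 2) * K) := by rw [Real.rpow_mul hn0.le, Real.rpow_natCast]
          _ ≤ (n : ℝ) ^ (-1 : ℝ) := by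
            apply Real.rpow_le_rpow_of_exponent_le hn1
            linarith
          _ = _ := Real.rpow_neg_one _
      calc _ ≤ (n : ℝ)⁻¹ * (Δ * n) := by gcongr
        _ = Δ := by field_simp
        _ ≤ _ := E5)
  refine le_trans ?_ hfix
  have hp2 : P / (2 * (K + 1)) ≤ 1 := by rw [div_le_one (by positivity)]; nlinarith
  have hp20 : 0 < P / (2 * (K + 1)) := by positivity
  have hB := one_add_mul_le_pow (a := -(P / (2 * ((K : ℝ) + 1)))) (by linarith) (K + 1)
  rw [← sub_eq_add_neg] at hB
  have hB2 : ((K + 1 : ℕ) : ℝ) * -(P / (2 * ((K : ℝ) + 1))) = -(P / 2) := by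
    push_cast; field_simp
  rw [hB2] at hB
  have hB3 := pow_le_one₀ (n := K + 1) (by linarith : 0 ≤ 1 - P / (2 * ((K : ℝ) + 1))) (by linarith)
  apply pr_anti _ _ hP1 (failH_anti H)
  · nlinarith
  · nlinarith

theorem conclude (ε : ℝ) (hε : 0 < ε) (Δ : ℕ) (hΔ : 2 ≤ Δ)
    (m : ℕ → ℕ) (H : ∀ n : ℕ, SimpleGraph (Fin (m n)))
    (hm : ∀ n, (m n : ℝ) ≤ (1 - ε) * n) (hH : ∀ n, maxDeg (H n) ≤ Δ)
    (p : ℕ → ℝ) (hp : ∀ n, 0 ≤ p n ∧ p n ≤ 1)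
    (hcond : Tendsto (fun n : ℕ =>
        p n * (n : ℝ) ^ ((2 : ℝ) / (Δ + 1)) /
          Real.log n ^ ((2 : ℝ) / ((Δ + 1) * Δ))) atTop atTop) :
    Tendsto (fun n : ℕ => gnp n (p n) {ω | ContainsCopy (H n) (graphOf ω)}) atTop (𝓝 1) := by
  have hΔr : (2 : ℝ) ≤ Δ := by exact_mod_cast hΔ
  have hε1 : ε ≤ 1 := by
    have h1 := hm 1
    have h2 : (0 : ℝ) ≤ m 1 := by positivity
    push_cast at h1
    linarith
  have hnat : Tendsto (fun n : ℕ => (n : ℝ)) atTop atTop := tendsto_natCast_atTop_atTop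
  have hlog : ∀ᶠ n : ℕ in atTop, (1 : ℝ) ≤ Real.log n :=
    (Real.tendsto_log_atTop.comp hnat).eventually_ge_atTop 1
  have hPn : Tendsto (fun n : ℕ => p n * (n : ℝ) ^ ((2 : ℝ) / (Δ + 1))) atTop atTop := by
    apply tendsto_atTop_mono' _ _ hcond
    filter_upwards [hlog] with n hn
    apply div_le_self
    · have := (hp n).1
      positivity
    · exact Real.one_le_rpow hn (by positivity)
  obtain ⟨a, ha⟩ : ∃ a : ℝ, a = 2 / ((Δ : ℝ) + 1) := ⟨_, rfl⟩
  obtain ⟨c₂, hc₂⟩ : ∃ c₂ : ℝ, c₂ = 2 * ((Δ : ℝ) + 1) / (Δ * (Δ + 2)) := ⟨_, rfl⟩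
  obtain ⟨γ, hγ⟩ : ∃ γ : ℝ, γ = c₂ - a := ⟨_, rfl⟩
  obtain ⟨κ, hκ⟩ : ∃ κ : ℝ, κ = 16 * Δ / ε ^ 2 := ⟨_, rfl⟩
  have hγ0 : 0 < γ := by
    rw [hγ, hc₂, ha, sub_pos, div_lt_div_iff₀ (by positivity) (by positivity)]
    nlinarith
  obtain ⟨K, hK'⟩ := exists_nat_ge (2 / γ)
  have hK : 2 ≤ γ * K := by
    rw [div_le_iff₀ hγ0] at hK'; linarith
  rw [← ha] at hPn
  have hγ4 : Tendsto (fun n : ℕ => (n : ℝ) ^ (γ / 4)) atTop atTop :=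
    (tendsto_rpow_atTop (by positivity)).comp hnat
  have hγ2 : Tendsto (fun n : ℕ => (n : ℝ) ^ (γ / 2)) atTop atTop :=
    (tendsto_rpow_atTop (by positivity)).comp hnat
  have hev : ∀ᶠ n : ℕ in atTop, pr (p n) (failH (V := Fin n) (H n)) ≤
      Real.exp (-(⌊ε * n / (2 * ((Δ : ℝ) + 1))⌋₊ : ℝ)) +
      (3 * (n : ℝ) ^ (-(γ / 4)) + K * Real.exp (-(n : ℝ) ^ (γ / 4))) := by
    filter_upwards [hnat.eventually_ge_atTop (4 * ((Δ : ℝ) + 1) / ε), hnat.eventually_ge_atTop κ,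
      hPn.eventually_ge_atTop (64 * κ ^ a * Δ * (Δ + 1) / ε), hPn.eventually_ge_atTop 1,
      hγ2.eventually_ge_atTop (16 * (K + 1) * κ ^ c₂), hγ4.eventually_ge_atTop (Δ : ℝ)]
      with n E1 E2 E3 E3' E4 E5
    refine main_n Δ (by omega) hε hε1 (H n) ?_ n ?_ (hp n).2 K ha hc₂ hγ hγ0 hK hκ E1 E2 E3 E3' E4 E5
    · exact deg_of_maxDeg (H n) Δ (hH n)
    · rw [Fintype.card_fin]; exact hm n
  have hlim : Tendsto (fun n : ℕ => Real.exp (-(⌊ε * n / (2 * ((Δ : ℝ) + 1))⌋₊ : ℝ)) +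
      (3 * (n : ℝ) ^ (-(γ / 4)) + K * Real.exp (-(n : ℝ) ^ (γ / 4)))) atTop (𝓝 0) := by
    have l1 : Tendsto (fun n : ℕ => Real.exp (-(⌊ε * n / (2 * ((Δ : ℝ) + 1))⌋₊ : ℝ))) atTop (𝓝 0) := by
      apply Real.tendsto_exp_neg_atTop_nhds_zero.comp
      apply hnat.comp
      apply tendsto_nat_floor_atTop.comp
      exact (hnat.const_mul_atTop hε).atTop_div_const (by positivity)
    have l2 : Tendsto (fun n : ℕ => (n : ℝ) ^ (-(γ / 4))) atTop (𝓝 0) :=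
      (tendsto_rpow_neg_atTop (by positivity)).comp hnat
    have l3 : Tendsto (fun n : ℕ => Real.exp (-(n : ℝ) ^ (γ / 4))) atTop (𝓝 0) :=
      Real.tendsto_exp_neg_atTop_nhds_zero.comp hγ4
    have := l1.add ((l2.const_mul 3).add (l3.const_mul (K : ℝ)))
    simpa using this
  have hlow : Tendsto (fun n : ℕ => ENNReal.ofReal (1 - (Real.exp (-(⌊ε * n / (2 * ((Δ : ℝ) + 1))⌋₊ : ℝ)) +
      (3 * (n : ℝ) ^ (-(γ / 4)) + K * Real.exp (-(n : ℝ) ^ (γ / 4)))))) atTop (𝓝 1) := by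
    have := ENNReal.tendsto_ofReal (hlim.const_sub 1)
    simpa using this
  refine tendsto_of_tendsto_of_tendsto_of_le_of_le' hlow tendsto_const_nhds ?_ ?_
  · filter_upwards [hev] with n hn
    refine le_trans (ENNReal.ofReal_le_ofReal ?_) (link n (H n) (hp n).1 (hp n).2)
    linarith
  · filter_upwards with n
    have := gnp_prob n (p n)
    exact prob_le_one

/-- **Ferber–Luh–Nguyen theorem.** Let `ε > 0` and `Δ ≥ 2` be fixed, and `(H_n)` a sequence of
graphs with `Δ(H_n) ≤ Δ` and `v(H_n) ≤ (1-ε)n`. If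
`p·n^{2/(Δ+1)}/(log n)^{1/binom(Δ+1,2)} → ∞` then a.a.s. `G(n,p)` contains a copy of `H_n`. -/
theorem stmt_11 (ε : ℝ) (hε : 0 < ε) (Δ : ℕ) (hΔ : 2 ≤ Δ)
    (m : ℕ → ℕ) (H : ∀ n : ℕ, SimpleGraph (Fin (m n)))
    (hm : ∀ n, (m n : ℝ) ≤ (1 - ε) * n) (hH : ∀ n, maxDeg (H n) ≤ Δ)
    (p : ℕ → ℝ) (hp : ∀ n, 0 ≤ p n ∧ p n ≤ 1)
    (hcond : Tendsto (fun n : ℕ =>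
        p n * (n : ℝ) ^ ((2 : ℝ) / (Δ + 1)) /
          Real.log n ^ ((2 : ℝ) / ((Δ + 1) * Δ))) atTop atTop) :
    Tendsto (fun n : ℕ => gnp n (p n) {ω | ContainsCopy (H n) (graphOf ω)}) atTop (𝓝 1) := by
  exact conclude ε hε Δ hΔ m H hm hH p hp hcond
end

section
/- For each Δ ≥ 3 there is a constant C such that if p ≥ C·(log n/n)^{1/Δ}, then a.a.s. G(n,p) is universal for 𝓗(n,Δ), i.e. G(n,p) simultaneously contains a copy of every graph on n vertices with maximum degree at most Δ. -/
open MeasureTheory Filter Topology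

/-! ### Probabilistic tools -/

lemma graphOf_adj {n : ℕ} (ω : Sym2 (Fin n) → Bool) (u v : Fin n) :
    (graphOf ω).Adj u v ↔ u ≠ v ∧ ω s(u, v) = true := by
  simp only [graphOf, SimpleGraph.fromRel_adj, Sym2.eq_swap (a := v) (b := u), or_self]

instance bern_prob_s12 (p : ℝ) : IsProbabilityMeasure (bernoulliMeasure p) :=
  ⟨by
    simp only [bernoulliMeasure, Measure.coe_add, Measure.coe_smul, Pi.add_apply, Pi.smul_apply,
      measure_univ, smul_eq_mul, mul_one]
    exact add_tsub_cancel_of_le (min_le_right _ _)⟩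

instance gnp_prob_s12 (n : ℕ) (p : ℝ) : IsProbabilityMeasure (gnp n p) := by
  unfold gnp; infer_instance

lemma om_meas {n : ℕ} (A : Set (Sym2 (Fin n) → Bool)) : MeasurableSet A :=
  A.toFinite.measurableSet

lemma gnp_all {n : ℕ} {p : ℝ} (h0 : 0 ≤ p) (h1 : p ≤ 1) (E : Finset (Sym2 (Fin n))) :
    (gnp n p).real {ω | ∀ e ∈ E, ω e = true} = p ^ E.card := by
  classical
  have : {ω : Sym2 (Fin n) → Bool | ∀ e ∈ E, ω e = true}
      = Set.pi Set.univ (fun e => if e ∈ E then {true} else Set.univ) := by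
    ext ω
    simp only [Set.mem_ofPred_eq, Set.mem_pi, Set.mem_univ, forall_true_left]
    refine forall_congr' fun e => ?_
    split_ifs with h <;> simp [h]
  have hb : bernoulliMeasure p {true} = ENNReal.ofReal p := by
    simp [bernoulliMeasure, h1]
  rw [this, Measure.real, gnp, Measure.pi_pi]
  have : ∀ e, bernoulliMeasure p (if e ∈ E then {true} else Set.univ)
      = if e ∈ E then ENNReal.ofReal p else 1 := by
    intro e; split_ifs
    · exact hb
    · exact measure_univ
  simp only [this]
  rw [Finset.prod_ite_mem, Finset.univ_inter, Finset.prod_const, ENNReal.toReal_pow,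
    ENNReal.toReal_ofReal h0]

lemma gnp_indep {n : ℕ} {p : ℝ} (S : Finset (Sym2 (Fin n))) (A B : Set (Sym2 (Fin n) → Bool))
    (hA : ∀ ω ω', (∀ e ∈ S, ω e = ω' e) → ω ∈ A → ω' ∈ A)
    (hB : ∀ ω ω', (∀ e, e ∉ S → ω e = ω' e) → ω ∈ B → ω' ∈ B) :
    (gnp n p).real (A ∩ B) = (gnp n p).real A * (gnp n p).real B := by
  classical
  have hi : ProbabilityTheory.iIndepFun (fun (e : Sym2 (Fin n)) (ω : Sym2 (Fin n) → Bool) => ω e)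
      (gnp n p) := by
    unfold gnp
    exact ProbabilityTheory.iIndepFun_pi (X := fun _ b => b) (fun _ => aemeasurable_id)
  have h2 := hi.indepFun_finset S Sᶜ disjoint_compl_right (fun e => measurable_pi_apply e)
  have h3 := h2.measure_inter_preimage_eq_mul
    ((fun a (i : S) => a i) '' A) ((fun a (i : (Sᶜ : Finset _)) => a i) '' B)
    (Set.toFinite _).measurableSet (Set.toFinite _).measurableSet
  have eA : (fun (a : Sym2 (Fin n) → Bool) (i : S) => a i) ⁻¹' ((fun a (i : S) => a i) '' A) = A := by
    refine Set.Subset.antisymm ?_ (Set.subset_preimage_image _ _)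
    rintro ω ⟨ω', h, e⟩
    exact hA ω' ω (fun x hx => congrFun e ⟨x, hx⟩) h
  have eB : (fun (a : Sym2 (Fin n) → Bool) (i : (Sᶜ : Finset _)) => a i) ⁻¹'
      ((fun a (i : (Sᶜ : Finset _)) => a i) '' B) = B := by
    refine Set.Subset.antisymm ?_ (Set.subset_preimage_image _ _)
    rintro ω ⟨ω', h, e⟩
    exact hB ω' ω (fun x hx => congrFun e ⟨x, by simpa using hx⟩) h
  rw [eA, eB] at h3
  simp only [Measure.real, h3, ENNReal.toReal_mul]

lemma prob_none {n : ℕ} {p : ℝ} (h0 : 0 ≤ p) (h1 : p ≤ 1) (Δ : ℕ) {κ : Type*} [DecidableEq κ]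
    (J : Finset κ) (E : κ → Finset (Sym2 (Fin n))) (hc : ∀ j ∈ J, (E j).card ≤ Δ)
    (hd : ∀ i ∈ J, ∀ j ∈ J, i ≠ j → Disjoint (E i) (E j)) :
    (gnp n p).real {ω | ∀ j ∈ J, ¬ ∀ e ∈ E j, ω e = true} ≤ Real.exp (-(p ^ Δ)) ^ J.card := by
  classical
  induction J using Finset.induction_on with
  | empty => simp
  | insert a J ha ih =>
    have e1 : {ω : Sym2 (Fin n) → Bool | ∀ j ∈ insert a J, ¬ ∀ e ∈ E j, ω e = true}
        = {ω | ∀ e ∈ E a, ω e = true}ᶜ ∩ {ω | ∀ j ∈ J, ¬ ∀ e ∈ E j, ω e = true} := by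
      ext ω
      simp only [Finset.mem_insert, forall_eq_or_imp, Set.mem_ofPred_eq, Set.mem_inter_iff,
        Set.mem_compl_iff]
    rw [e1, gnp_indep (E a), Finset.card_insert_of_notMem ha, pow_succ, mul_comm]
    · refine mul_le_mul (ih (fun j hj => hc j (Finset.mem_insert_of_mem hj))
        (fun i hi j hj => hd i (Finset.mem_insert_of_mem hi) j (Finset.mem_insert_of_mem hj))) ?_
        measureReal_nonneg (by positivity)
      rw [probReal_compl_eq_one_sub (om_meas _), gnp_all h0 h1]
      have : p ^ Δ ≤ p ^ (E a).card := pow_le_pow_of_le_one h0 h1 (hc a (Finset.mem_insert_self _ _))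
      have := Real.add_one_le_exp (-(p ^ Δ))
      linarith
    · intro ω ω' h hω h'
      exact hω fun e he => (h e he).trans (h' e he)
    · intro ω ω' h hω j hj h'
      refine hω j hj fun e he => (h e ?_).trans (h' e he)
      have := hd j (Finset.mem_insert_of_mem hj) a (Finset.mem_insert_self _ _)
        (fun h => ha (h ▸ hj))
      exact Finset.disjoint_left.1 this he

lemma prob_hole {n : ℕ} {p : ℝ} (h0 : 0 ≤ p) (h1 : p ≤ 1) (Δ : ℕ) {ι : Type*} [DecidableEq ι]
    (A : Finset ι) (T : ι → Finset (Fin n)) (W : Finset (Fin n)) (hc : ∀ j ∈ A, (T j).card ≤ Δ)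
    (hd : ∀ i ∈ A, ∀ j ∈ A, i ≠ j → Disjoint (T i) (T j))
    (hW : ∀ i ∈ A, Disjoint (T i) W) :
    (gnp n p).real {ω | ∀ i ∈ A, ∀ w ∈ W, ¬ ∀ t ∈ T i, (graphOf ω).Adj w t}
      ≤ Real.exp (-(p ^ Δ)) ^ (A.card * W.card) := by
  classical
  have := prob_none (n := n) h0 h1 Δ (A ×ˢ W) (fun x => (T x.1).image (fun t => s(x.2, t)))
    (fun x hx => Finset.card_image_le.trans (hc _ (Finset.mem_product.1 hx).1)) ?_
  · rw [Finset.card_product] at this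
    refine le_trans (measureReal_mono ?_) this
    intro ω hω x hx hall
    obtain ⟨hx1, hx2⟩ := Finset.mem_product.1 hx
    refine hω x.1 hx1 x.2 hx2 fun t ht => ?_
    rw [graphOf_adj]
    refine ⟨?_, hall _ (Finset.mem_image_of_mem _ ht)⟩
    rintro rfl
    exact Finset.disjoint_left.1 (hW _ hx1) ht hx2
  · rintro ⟨i, w⟩ hx ⟨j, v⟩ hy hne
    simp only [Finset.mem_product] at hx hy
    rw [Finset.disjoint_left]
    intro e he he'
    simp only [Finset.mem_image] at he he'
    obtain ⟨t, ht, rfl⟩ := he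
    obtain ⟨t', ht', h⟩ := he'
    rw [Sym2.eq_iff] at h
    rcases h with ⟨rfl, rfl⟩ | ⟨rfl, rfl⟩
    · have : i ≠ j := fun h => hne (by rw [h])
      exact Finset.disjoint_left.1 (hd i hx.1 j hy.1 this) ht ht'
    · exact Finset.disjoint_left.1 (hW i hx.1) ht hy.2

lemma union_bound {n : ℕ} {p : ℝ} {κ : Type*} [Fintype κ] (f : κ → Set (Sym2 (Fin n) → Bool))
    (c : ℝ) (h : ∀ k, (gnp n p).real (f k) ≤ c) :
    (gnp n p).real {ω | ∃ k, ω ∈ f k} ≤ Fintype.card κ * c := by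
  have e : {ω | ∃ k, ω ∈ f k} = ⋃ k ∈ (Finset.univ : Finset κ), f k := by ext; simp
  rw [e]
  refine (measureReal_biUnion_finset_le _ _).trans ?_
  refine (Finset.sum_le_sum fun k _ => h k).trans ?_
  simp [Finset.card_univ]

/-- decode a tuple of optional elements as a finite set -/
def decode {α : Type*} [DecidableEq α] {m : ℕ} (g : Fin m → Option α) : Finset α :=
  Finset.univ.biUnion fun i => (g i).toFinset

lemma decode_card_le {α : Type*} [DecidableEq α] {m : ℕ} (g : Fin m → Option α) :
    (decode g).card ≤ m := by
  refine Finset.card_biUnion_le.trans ?_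
  refine (Finset.sum_le_sum (g := fun _ => 1) fun i _ => ?_).trans (by simp)
  cases g i <;> simp

lemma exists_decode {α : Type*} [DecidableEq α] {m : ℕ} (s : Finset α) (h : s.card ≤ m) :
    ∃ g : Fin m → Option α, decode g = s := by
  refine ⟨fun i => if h : i.1 < s.card then some (s.equivFin.symm ⟨i, h⟩).1 else none, ?_⟩
  ext x
  simp only [decode, Finset.mem_biUnion, Finset.mem_univ, true_and, Option.mem_toFinset,
    Option.mem_def]
  constructor
  · rintro ⟨i, hi⟩
    split_ifs at hi with hh
    simp only [Option.some.injEq] at hi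
    rw [← hi]; exact Subtype.prop _
  · intro hx
    refine ⟨⟨s.equivFin ⟨x, hx⟩, (Fin.is_lt _).trans_le h⟩, ?_⟩
    simp

/-- The interval `[a,b)` in `Fin n`. -/
def itv (n a b : ℕ) : Finset (Fin n) := Finset.univ.filter fun v => a ≤ v.1 ∧ v.1 < b

open Classical in
/-- The vertices of `W` adjacent to all of some `T i`, `i ∈ A`. -/
noncomputable def hits {n : ℕ} {ι : Type*} (G : SimpleGraph (Fin n)) (W : Finset (Fin n))
    (A : Finset ι) (T : ι → Finset (Fin n)) : Finset (Fin n) :=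
  W.filter fun w => ∃ i ∈ A, ∀ t ∈ T i, G.Adj w t

open Classical in
/-- The indices `i` such that all of `T i` is adjacent to some vertex of `S`. -/
noncomputable def dhits {n : ℕ} {ι : Type*} [Fintype ι] (G : SimpleGraph (Fin n))
    (S : Finset (Fin n)) (T : ι → Finset (Fin n)) : Finset ι :=
  Finset.univ.filter fun i => ∃ w ∈ S, ∀ t ∈ T i, G.Adj w t

lemma mem_hits {n : ℕ} {ι : Type*} (G : SimpleGraph (Fin n)) (W : Finset (Fin n))
    (A : Finset ι) (T : ι → Finset (Fin n)) (w : Fin n) :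
    w ∈ hits G W A T ↔ w ∈ W ∧ ∃ i ∈ A, ∀ t ∈ T i, G.Adj w t := by
  simp only [hits, Finset.mem_filter]

lemma hits_subset {n : ℕ} {ι : Type*} (G : SimpleGraph (Fin n)) (W : Finset (Fin n))
    (A : Finset ι) (T : ι → Finset (Fin n)) : hits G W A T ⊆ W :=
  fun w hw => ((mem_hits G W A T w).1 hw).1

lemma mem_dhits {n : ℕ} {ι : Type*} [Fintype ι] (G : SimpleGraph (Fin n))
    (S : Finset (Fin n)) (T : ι → Finset (Fin n)) (i : ι) :
    i ∈ dhits G S T ↔ ∃ w ∈ S, ∀ t ∈ T i, G.Adj w t := by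
  simp only [dhits, Finset.mem_filter, Finset.mem_univ, true_and]

lemma mem_itv {n a b : ℕ} (v : Fin n) : v ∈ itv n a b ↔ a ≤ v.1 ∧ v.1 < b := by
  simp [itv]

def PropA {n : ℕ} (Δ e : ℕ) (G : SimpleGraph (Fin n)) : Prop :=
  ∀ a b : ℕ, a ≤ n → b ≤ n → ∀ k, k ≤ n → ∀ T : Fin k → Finset (Fin n),
    (∀ i, (T i).card ≤ Δ) → (∀ i j, i ≠ j → Disjoint (T i) (T j)) →
    (∀ i, Disjoint (T i) (itv n a b)) →
    k ≤ (hits G (itv n a b) Finset.univ T).card ∨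
      (itv n a b).card ≤ (hits G (itv n a b) Finset.univ T).card + e

def PropB {n : ℕ} {ι : Type*} [Fintype ι] (m : ℕ) (I : Finset (Fin n)) (T : ι → Finset (Fin n))
    (G : SimpleGraph (Fin n)) : Prop :=
  ∀ S : Finset (Fin n), Disjoint S I → S.card ≤ m → S.card ≤ (dhits G S T).card

lemma geom_aux (n : ℕ) (x : ℝ) (hx : 0 ≤ x) (d : ℕ) (h : x * ((n : ℝ) + 1) ^ (d + 4) ≤ 1) (k : ℕ) :
    ((n : ℝ) + 1) ^ (d * (k + 1)) * x ^ (k + 1) ≤ (((n : ℝ) + 1) ^ 4)⁻¹ := by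
  have h1 : (1 : ℝ) ≤ ((n : ℝ) + 1) ^ 4 := one_le_pow₀ (by linarith [Nat.cast_nonneg (α := ℝ) n])
  rw [pow_mul, ← mul_pow]
  have h2 : ((n : ℝ) + 1) ^ d * x ≤ (((n : ℝ) + 1) ^ 4)⁻¹ := by
    rw [← one_div, le_div_iff₀ (by positivity)]
    refine le_trans (le_of_eq ?_) h
    ring
  refine (pow_le_of_le_one (by positivity) (h2.trans (inv_le_one_of_one_le₀ h1)) (by simp)).trans h2

lemma prob_A {n : ℕ} {p : ℝ} (h0 : 0 ≤ p) (h1 : p ≤ 1) (Δ e : ℕ)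
    (he : Real.exp (-(p ^ Δ)) ^ e * ((n : ℝ) + 1) ^ (Δ + 1 + 4) ≤ 1) :
    (gnp n p).real {ω | ¬ PropA Δ e (graphOf ω)} ≤ ((n : ℝ) + 1)⁻¹ := by
  classical
  set F : (x : Fin (n + 1) × Fin (n + 1) × Fin n) →
      ((Fin (x.2.2 + 1) → Fin Δ → Option (Fin n)) × (Fin (x.2.2 + 1) → Option (Fin n))) →
      Set (Sym2 (Fin n) → Bool) := fun x g =>
    {ω | ((∀ i j, i ≠ j → Disjoint (decode (g.1 i)) (decode (g.1 j))) ∧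
      (∀ i, Disjoint (decode (g.1 i)) (itv n x.1 x.2.1)) ∧
      e ≤ (itv n x.1 x.2.1 \ decode g.2).card) ∧
      (∀ i ∈ Finset.univ, ∀ w ∈ itv n x.1 x.2.1 \ decode g.2,
        ¬ ∀ t ∈ decode (g.1 i), (graphOf ω).Adj w t)} with hF
  have hx0 : 0 ≤ Real.exp (-(p ^ Δ)) := (Real.exp_pos _).le
  have hx1 : Real.exp (-(p ^ Δ)) ≤ 1 := Real.exp_le_one_iff.2 (by simpa using pow_nonneg h0 Δ)
  have hFb : ∀ x g, (gnp n p).real (F x g) ≤ (Real.exp (-(p ^ Δ)) ^ e) ^ (x.2.2.1 + 1) := by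
    intro x g
    by_cases hcond : (∀ i j, i ≠ j → Disjoint (decode (g.1 i)) (decode (g.1 j))) ∧
      (∀ i, Disjoint (decode (g.1 i)) (itv n x.1 x.2.1)) ∧
      e ≤ (itv n x.1 x.2.1 \ decode g.2).card
    · have := prob_hole h0 h1 Δ Finset.univ (fun i => decode (g.1 i))
        (itv n x.1 x.2.1 \ decode g.2) (fun i _ => decode_card_le _)
        (fun i _ j _ => hcond.1 i j) (fun i _ => (hcond.2.1 i).mono_right Finset.sdiff_subset)
      refine (measureReal_mono ?_).trans (this.trans ?_)
      · intro ω hω; exact hω.2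
      · rw [← pow_mul, Finset.card_univ, Fintype.card_fin, mul_comm e]
        exact pow_le_pow_of_le_one hx0 hx1 (Nat.mul_le_mul_left _ hcond.2.2)
    · have : F x g = ∅ := by
        ext ω
        simp only [hF, Set.mem_empty_iff_false, iff_false]
        exact fun h => hcond h.1
      rw [this]; simp only [measureReal_empty]; positivity
  have hF2 : ∀ x, (gnp n p).real {ω | ∃ g, ω ∈ F x g} ≤ (((n : ℝ) + 1) ^ 4)⁻¹ := by
    intro x
    refine (union_bound _ _ (hFb x)).trans ?_
    refine le_trans (le_of_eq ?_) (geom_aux n _ (by positivity) (Δ + 1) he x.2.2.1)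
    congr 1
    simp only [Fintype.card_prod, Fintype.card_fun, Fintype.card_fin, Fintype.card_option]
    push_cast
    ring
  have hF3 := union_bound (n := n) (p := p) _ _ hF2
  refine (measureReal_mono ?_).trans (hF3.trans ?_)
  · intro ω hω
    simp only [PropA, Set.mem_ofPred_eq] at hω
    push Not at hω
    obtain ⟨a, b, ha, hb, k, hk, T, hT1, hT2, hT3, hlt1, hlt2⟩ := hω
    obtain ⟨k, rfl⟩ : ∃ k', k = k' + 1 := ⟨k - 1, by omega⟩
    choose gT hgT using fun i => exists_decode (T i) (hT1 i)
    obtain ⟨gU, hgU⟩ := exists_decode _ hlt1.le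
    refine ⟨⟨⟨a, by omega⟩, ⟨b, by omega⟩, ⟨k, by omega⟩⟩, ⟨gT, gU⟩, ⟨?_, ?_, ?_⟩, ?_⟩
    · intro i j hij; rw [hgT, hgT]; exact hT2 i j hij
    · intro i; rw [hgT]; exact hT3 i
    · rw [hgU]
      simp only
      rw [Finset.card_sdiff_of_subset (hits_subset _ _ _ _)]
      omega
    · intro i _ w hw hall
      rw [hgU, Finset.mem_sdiff] at hw
      refine hw.2 ((mem_hits _ _ _ _ _).2 ⟨hw.1, i, Finset.mem_univ _, ?_⟩)
      simpa only [hgT] using hall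
  · simp only [Fintype.card_prod, Fintype.card_fin]
    push_cast
    have : (0 : ℝ) < (n : ℝ) + 1 := by positivity
    rw [← div_eq_mul_inv, div_le_iff₀ (by positivity), pow_succ' _ 3, inv_mul_cancel_left₀ this.ne',
      pow_succ, pow_two]
    have hn : (0 : ℝ) ≤ n := Nat.cast_nonneg n
    nlinarith [mul_nonneg this.le this.le]

lemma prob_B {n : ℕ} {p : ℝ} (h0 : 0 ≤ p) (h1 : p ≤ 1) (Δ e N m : ℕ) (hΔ : 1 ≤ Δ)
    (he : Real.exp (-(p ^ Δ)) ^ e * ((n : ℝ) + 1) ^ (Δ + 1 + 4) ≤ 1) (hN : N ≤ n)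
    (hm : m + e ≤ N) (hmn : m ≤ n)
    (I : Finset (Fin n)) (T : Fin N → Finset (Fin n)) (hc : ∀ i, (T i).card ≤ Δ)
    (hd : ∀ i j, i ≠ j → Disjoint (T i) (T j)) (hI : ∀ i, T i ⊆ I) :
    (gnp n p).real {ω | ¬ PropB m I T (graphOf ω)} ≤ ((n : ℝ) + 1)⁻¹ := by
  classical
  set F : (k : Fin n) →
      ((Fin (k + 1) → Option (Fin n)) × (Fin (k + 1) → Option (Fin N))) →
      Set (Sym2 (Fin n) → Bool) := fun k g =>
    {ω | (Disjoint (decode g.1) I ∧ (decode g.1).card = k + 1 ∧ k + 1 ≤ m) ∧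
      (∀ i ∈ (decode g.2)ᶜ, ∀ w ∈ decode g.1,
        ¬ ∀ t ∈ T i, (graphOf ω).Adj w t)} with hF
  have hx0 : 0 ≤ Real.exp (-(p ^ Δ)) := (Real.exp_pos _).le
  have hx1 : Real.exp (-(p ^ Δ)) ≤ 1 := Real.exp_le_one_iff.2 (by simpa using pow_nonneg h0 Δ)
  have he' : Real.exp (-(p ^ Δ)) ^ e * ((n : ℝ) + 1) ^ (2 + 4) ≤ 1 := by
    refine le_trans (mul_le_mul_of_nonneg_left (pow_le_pow_right₀ ?_ ?_) (by positivity)) he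
    · linarith [Nat.cast_nonneg (α := ℝ) n]
    · omega
  have hFb : ∀ k g, (gnp n p).real (F k g) ≤ (Real.exp (-(p ^ Δ)) ^ e) ^ (k.1 + 1) := by
    intro k g
    by_cases hcond : Disjoint (decode g.1) I ∧ (decode g.1).card = k + 1 ∧ k.1 + 1 ≤ m
    · have := prob_hole h0 h1 Δ (decode g.2)ᶜ T (decode g.1) (fun i _ => hc i)
        (fun i _ j _ => hd i j) (fun i _ => (hcond.1.symm.mono_left (hI i)))
      refine (measureReal_mono ?_).trans (this.trans ?_)
      · intro ω hω; exact hω.2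
      · rw [← pow_mul, hcond.2.1, Finset.card_compl, Fintype.card_fin]
        refine pow_le_pow_of_le_one hx0 hx1 (Nat.mul_le_mul_right _ ?_)
        have := decode_card_le g.2
        have := hcond.2.2
        omega
    · have : F k g = ∅ := by
        ext ω
        simp only [hF, Set.mem_empty_iff_false, iff_false]
        exact fun h => hcond h.1
      rw [this]; simp only [measureReal_empty]; positivity
  have hF2 : ∀ k, (gnp n p).real {ω | ∃ g, ω ∈ F k g} ≤ (((n : ℝ) + 1) ^ 4)⁻¹ := by
    intro k
    refine (union_bound _ _ (hFb k)).trans ?_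
    refine le_trans (mul_le_mul_of_nonneg_right ?_ (by positivity))
      (geom_aux n _ (by positivity) 2 he' k.1)
    simp only [Fintype.card_prod, Fintype.card_fun, Fintype.card_fin, Fintype.card_option]
    push_cast
    rw [pow_mul, ← mul_pow, pow_two]
    have : (N : ℝ) ≤ n := by exact_mod_cast hN
    gcongr
  have hF3 := union_bound (n := n) (p := p) _ _ hF2
  refine (measureReal_mono ?_).trans (hF3.trans ?_)
  · intro ω hω
    simp only [PropB, Set.mem_ofPred_eq] at hω
    push Not at hω
    obtain ⟨S, hS1, hS2, hS3⟩ := hω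
    obtain ⟨k, hk⟩ : ∃ k', S.card = k' + 1 := ⟨S.card - 1, by omega⟩
    rw [hk] at hS3 hS2
    obtain ⟨gS, hgS⟩ := exists_decode S hk.le
    obtain ⟨gU, hgU⟩ := exists_decode _ hS3.le
    refine ⟨⟨k, by omega⟩, ⟨gS, gU⟩, ⟨?_, ?_, hS2⟩, ?_⟩
    · rw [hgS]; exact hS1
    · rw [hgS]; exact hk
    · intro i hi w hw hall
      rw [Finset.mem_compl, hgU] at hi
      rw [hgS] at hw
      exact hi ((mem_dhits _ _ _ _).2 ⟨w, hw, hall⟩)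
  · simp only [Fintype.card_fin]
    have hn : (0 : ℝ) ≤ n := Nat.cast_nonneg n
    have : (0 : ℝ) < (n : ℝ) + 1 := by positivity
    rw [← div_eq_mul_inv, div_le_iff₀ (by positivity), pow_succ' _ 3, inv_mul_cancel_left₀ this.ne']
    have := le_self_pow₀ (a := (n : ℝ) + 1) (by linarith) (show 3 ≠ 0 by simp)
    linarith

/-- A family of disjoint `d`-cliques inside `I`. -/
def CliqueFam {n : ℕ} (N d : ℕ) (I : Finset (Fin n)) (G : SimpleGraph (Fin n))
    (T : Fin N → Finset (Fin n)) : Prop :=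
  (∀ i, T i ⊆ I) ∧ (∀ i, (T i).card = d) ∧ (∀ i j, i ≠ j → Disjoint (T i) (T j)) ∧
    ∀ i, ∀ u ∈ T i, ∀ v ∈ T i, u ≠ v → G.Adj u v

open Classical in
noncomputable def selFam {α : Type*} (P : α → Prop) (dflt : α) : α :=
  if h : ∃ x, P x then h.choose else dflt

lemma prob_sel {n : ℕ} {p : ℝ} (h0 : 0 ≤ p) (h1 : p ≤ 1) (Δ e N m d : ℕ) (hΔ : 1 ≤ Δ)
    (he : Real.exp (-(p ^ Δ)) ^ e * ((n : ℝ) + 1) ^ (Δ + 1 + 4) ≤ 1) (hN : N ≤ n)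
    (hm : m + e ≤ N) (hmn : m ≤ n) (hd : d ≤ Δ) (I : Finset (Fin n)) :
    (gnp n p).real {ω | ¬ PropB m I (selFam (CliqueFam N d I (graphOf ω)) fun _ => ∅) (graphOf ω)}
      ≤ ((n : ℝ) + 1)⁻¹ := by
  classical
  set sel : (Sym2 (Fin n) → Bool) → (Fin N → Finset (Fin n)) :=
    fun ω => selFam (CliqueFam N d I (graphOf ω)) fun _ => ∅ with hsel
  have hgood : ∀ ω, (∀ i, (sel ω i).card ≤ Δ) ∧ (∀ i j, i ≠ j → Disjoint (sel ω i) (sel ω j)) ∧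
      (∀ i, sel ω i ⊆ I) := by
    intro ω
    simp only [hsel, selFam]
    split_ifs with h
    · have := h.choose_spec
      exact ⟨fun i => (this.2.1 i).trans_le hd, this.2.2.1, this.1⟩
    · simp
  set S : Finset (Sym2 (Fin n)) := I.sym2 with hS
  have hdep : ∀ ω ω', (∀ x ∈ S, ω x = ω' x) → sel ω = sel ω' := by
    intro ω ω' h
    have : CliqueFam N d I (graphOf ω) = CliqueFam N d I (graphOf ω') := by
      funext T
      simp only [CliqueFam, eq_iff_iff]
      refine and_congr_right fun hT => and_congr_right fun _ => and_congr_right fun _ => ?_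
      refine forall_congr' fun i => forall₂_congr fun u hu => forall₂_congr fun v hv => ?_
      rw [graphOf_adj, graphOf_adj, h _ (by simp [hS, hT i hu, hT i hv])]
    simp only [hsel, this]
  have hbdep : ∀ T : Fin N → Finset (Fin n), (∀ i, T i ⊆ I) → ∀ ω ω', (∀ x, x ∉ S → ω x = ω' x) →
      ¬ PropB m I T (graphOf ω) → ¬ PropB m I T (graphOf ω') := by
    intro T hT ω ω' h hB hB'
    refine hB fun A hA hAm => ?_
    have : dhits (graphOf ω) A T = dhits (graphOf ω') A T := by
      simp only [dhits]
      refine Finset.filter_congr fun i _ => exists_congr fun w => and_congr_right fun hw => ?_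
      refine forall₂_congr fun t ht => ?_
      rw [graphOf_adj, graphOf_adj, h]
      simp only [hS, Finset.mk_mem_sym2_iff, not_and]
      exact fun h => absurd h (Finset.disjoint_left.1 hA hw)
    rw [this]; exact hB' A hA hAm
  have e1 : {ω | ¬ PropB m I (sel ω) (graphOf ω)} =
      ⋃ T ∈ (Finset.univ : Finset (Fin N → Finset (Fin n))),
        ({ω | sel ω = T} ∩ {ω | ¬ PropB m I T (graphOf ω)}) := by
    ext ω
    simp
  rw [e1]
  refine (measureReal_biUnion_finset_le _ _).trans ?_
  have e2 : ∀ T ∈ (Finset.univ : Finset (Fin N → Finset (Fin n))),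
      (gnp n p).real ({ω | sel ω = T} ∩ {ω | ¬ PropB m I T (graphOf ω)}) ≤
      (gnp n p).real {ω | sel ω = T} * ((n : ℝ) + 1)⁻¹ := by
    intro T _
    by_cases hT : ∃ ω, sel ω = T
    · obtain ⟨ω, rfl⟩ := hT
      obtain ⟨g1, g2, g3⟩ := hgood ω
      rw [gnp_indep S]
      · exact mul_le_mul_of_nonneg_left
          (prob_B h0 h1 Δ e N m hΔ he hN hm hmn I _ g1 g2 g3) measureReal_nonneg
      · intro ω₁ ω₂ h h'
        exact (hdep _ _ h).symm.trans h'
      · intro ω₁ ω₂ h h'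
        exact hbdep _ g3 _ _ h h'
    · have : {ω | sel ω = T} = ∅ := by
        ext ω; simp only [Set.mem_ofPred_eq, Set.mem_empty_iff_false, iff_false]
        exact fun h => hT ⟨ω, h⟩
      rw [this]; simp
  refine (Finset.sum_le_sum e2).trans ?_
  rw [← Finset.sum_mul]
  have e3 : ∑ T : Fin N → Finset (Fin n), (gnp n p).real {ω | sel ω = T} = 1 := by
    rw [← measureReal_biUnion_finset]
    · have : (⋃ T ∈ (Finset.univ : Finset (Fin N → Finset (Fin n))), {ω | sel ω = T}) = Set.univ := by
        ext ω; simp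
      rw [this]; exact probReal_univ
    · intro T _ T' _ hne
      refine Set.disjoint_left.2 fun ω h h' => hne ?_
      exact (show sel ω = T from h).symm.trans h'
    · intro T _; exact om_meas _
  rw [e3, one_mul]
/-! ### Deterministic embedding -/

lemma itv_card {n a b : ℕ} (hb : b ≤ n) : (itv n a b).card = b - a := by
  have : (itv n a b).map Fin.valEmbedding = Finset.Ico a b := by
    ext x
    simp only [Finset.mem_map, mem_itv, Fin.valEmbedding_apply, Finset.mem_Ico]
    constructor
    · rintro ⟨v, hv, rfl⟩; exact hv
    · intro hx; exact ⟨⟨x, by omega⟩, hx, rfl⟩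
  rw [← Finset.card_map Fin.valEmbedding, this, Nat.card_Ico]

lemma propA_gen {n Δ e : ℕ} {G : SimpleGraph (Fin n)} (hA : PropA Δ e G) {a b : ℕ} (ha : a ≤ n)
    (hb : b ≤ n) {ι : Type*} (A : Finset ι) (hAn : A.card ≤ n) (T : ι → Finset (Fin n))
    (h1 : ∀ i ∈ A, (T i).card ≤ Δ) (h2 : ∀ i ∈ A, ∀ j ∈ A, i ≠ j → Disjoint (T i) (T j))
    (h3 : ∀ i ∈ A, Disjoint (T i) (itv n a b)) :
    A.card ≤ (hits G (itv n a b) A T).card ∨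
      (itv n a b).card ≤ (hits G (itv n a b) A T).card + e := by
  have key : hits G (itv n a b) Finset.univ (fun i => T (A.equivFin.symm i).1)
      = hits G (itv n a b) A T := by
    ext w
    simp only [mem_hits, Finset.mem_univ, true_and]
    refine and_congr_right fun _ => ⟨?_, ?_⟩
    · rintro ⟨i, hi⟩; exact ⟨_, Subtype.prop _, hi⟩
    · rintro ⟨i, hi, h⟩; exact ⟨A.equivFin ⟨i, hi⟩, by simpa using h⟩
  rw [← key]
  refine hA a b ha hb _ hAn _ (fun i => h1 _ (Subtype.prop _)) (fun i j hij => ?_)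
    (fun i => h3 _ (Subtype.prop _))
  refine h2 _ (Subtype.prop _) _ (Subtype.prop _) fun h => hij ?_
  exact A.equivFin.symm.injective (Subtype.ext h)

lemma hall_gen {n : ℕ} (G : SimpleGraph (Fin n)) (W : Finset (Fin n)) {ι : Type*}
    (P : ι → Finset (Fin n)) (h : ∀ A : Finset ι, A.card ≤ (hits G W A P).card) :
    ∃ φ : ι → Fin n, Function.Injective φ ∧ ∀ i, φ i ∈ W ∧ ∀ t ∈ P i, G.Adj (φ i) t := by
  classical
  obtain ⟨φ, hφ, hφ2⟩ := (Finset.all_card_le_biUnion_card_iff_exists_injective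
    (fun i => hits G W {i} P)).1 (by
      intro A
      refine (h A).trans (Finset.card_le_card ?_)
      intro w hw
      obtain ⟨h1, i, hi, h2⟩ := (mem_hits _ _ _ _ _).1 hw
      exact Finset.mem_biUnion.2 ⟨i, hi, (mem_hits _ _ _ _ _).2 ⟨h1, i, by simp, h2⟩⟩)
  refine ⟨φ, hφ, fun i => ?_⟩
  have := (mem_hits _ _ _ _ _).1 (hφ2 i)
  simpa using this

lemma hall_step {n Δ e : ℕ} {G : SimpleGraph (Fin n)} (hA : PropA Δ e G) {a b : ℕ} (ha : a ≤ n)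
    (hb : b ≤ n) {ι : Type*} [Fintype ι] (P : ι → Finset (Fin n))
    (h1 : ∀ i, (P i).card ≤ Δ) (h2 : ∀ i j, i ≠ j → Disjoint (P i) (P j))
    (h3 : ∀ i, Disjoint (P i) (itv n a b)) (hc : a + Fintype.card ι + e ≤ b) :
    ∃ φ : ι → Fin n, Function.Injective φ ∧
      ∀ i, φ i ∈ itv n a b ∧ ∀ t ∈ P i, G.Adj (φ i) t := by
  refine hall_gen G _ P fun A => ?_
  have hAc : A.card ≤ Fintype.card ι := Finset.card_le_univ A
  have := propA_gen hA ha hb A (by omega) P (fun i _ => h1 i) (fun i _ j _ => h2 i j)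
    (fun i _ => h3 i)
  rw [itv_card hb] at this
  omega

lemma exists_cliques {n Δ e N : ℕ} {G : SimpleGraph (Fin n)} (hA : PropA Δ e G) (a d : ℕ)
    (hd : d ≤ Δ) (hn : a + d * (N + e) ≤ n) :
    ∃ T, CliqueFam N d (itv n a (a + d * (N + e))) G T := by
  classical
  induction d with
  | zero => exact ⟨fun _ => ∅, by simp [CliqueFam]⟩
  | succ d ih =>
    rw [Nat.succ_mul] at hn
    obtain ⟨T, hT1, hT2, hT3, hT4⟩ := ih (by omega) (by omega)
    obtain ⟨φ, hφ, hφ2⟩ := hall_step hA (a := a + d * (N + e)) (b := a + (d * (N + e) + (N + e)))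
      (by omega) (by omega) T (fun i => by rw [hT2]; omega) hT3 (fun i => by
        rw [Finset.disjoint_left]
        intro v hv hv'
        have := hT1 i hv
        rw [mem_itv] at this hv'
        omega) (by simp only [Fintype.card_fin]; omega)
    have hnot : ∀ i j, φ i ∉ T j := by
      intro i j h
      have h1 := hT1 j h
      have h2 := (hφ2 i).1
      rw [mem_itv] at h1 h2
      omega
    refine ⟨fun i => insert (φ i) (T i), ?_, ?_, ?_, ?_⟩
    · intro i v hv
      rw [Nat.succ_mul]
      rcases Finset.mem_insert.1 hv with rfl | hv
      · have := (hφ2 i).1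
        rw [mem_itv] at this ⊢; omega
      · have := hT1 i hv
        rw [mem_itv] at this ⊢; omega
    · intro i
      rw [Finset.card_insert_of_notMem (hnot i i), hT2]
    · intro i j hij
      simp only [Finset.disjoint_insert_left, Finset.disjoint_insert_right, Finset.mem_insert,
        not_or]
      exact ⟨⟨fun h => hij (hφ h.symm), hnot j i⟩, hnot i j, hT3 i j hij⟩
    · intro i u hu v hv huv
      rcases Finset.mem_insert.1 hu with rfl | hu <;> rcases Finset.mem_insert.1 hv with rfl | hv
      · exact absurd rfl huv
      · exact (hφ2 i).2 v hv
      · exact ((hφ2 i).2 u hu).symm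
      · exact hT4 i u hu v hv huv

/-- partial embedding on `D` with values below `b` -/
def PEmb {n : ℕ} (H G : SimpleGraph (Fin n)) (D : Finset (Fin n)) (b : ℕ) (f : Fin n → Fin n) :
    Prop :=
  (∀ u ∈ D, ∀ v ∈ D, f u = f v → u = v) ∧ (∀ u ∈ D, ∀ v ∈ D, H.Adj u v → G.Adj (f u) (f v)) ∧
    ∀ v ∈ D, (f v).1 < b

open Classical in
/-- neighbourhood as a finset -/
noncomputable def nb {n : ℕ} (H : SimpleGraph (Fin n)) (v : Fin n) : Finset (Fin n) :=
  Finset.univ.filter fun w => H.Adj v w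

lemma mem_nb {n : ℕ} (H : SimpleGraph (Fin n)) (v w : Fin n) : w ∈ nb H v ↔ H.Adj v w := by
  simp [nb]

lemma class_step {n Δ e : ℕ} {H G : SimpleGraph (Fin n)} (hA : PropA Δ e G)
    (hdeg : ∀ v, (nb H v).card ≤ Δ) (D C : Finset (Fin n)) (b : ℕ) (f : Fin n → Fin n)
    (hf : PEmb H G D b f) (hDC : Disjoint D C)
    (hC1 : ∀ u ∈ C, ∀ v ∈ C, u ≠ v → ¬ H.Adj u v)
    (hC2 : ∀ u ∈ C, ∀ v ∈ C, u ≠ v → ∀ w, H.Adj u w → ¬ H.Adj v w)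
    (hb : b + C.card + e ≤ n) :
    ∃ f', PEmb H G (D ∪ C) (b + C.card + e) f' ∧ ∀ v ∈ D, f' v = f v := by
  classical
  obtain ⟨φ, hφ, hφ2⟩ := hall_step hA (a := b) (b := b + C.card + e) (by omega) hb
    (ι := C) (fun v => (D ∩ nb H v).image f)
    (fun v => Finset.card_image_le.trans
      ((Finset.card_le_card Finset.inter_subset_right).trans (hdeg v)))
    (by
      intro u v huv
      rw [Finset.disjoint_left]
      intro y hy hy'
      simp only [Finset.mem_image, Finset.mem_inter, mem_nb] at hy hy'
      obtain ⟨w, ⟨hw, hw'⟩, rfl⟩ := hy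
      obtain ⟨z, ⟨hz, hz'⟩, h⟩ := hy'
      obtain rfl := hf.1 _ hz _ hw h
      exact hC2 u u.2 v v.2 (fun h => huv (Subtype.ext h)) _ hw' hz')
    (by
      intro v
      rw [Finset.disjoint_left]
      intro y hy hy'
      simp only [Finset.mem_image, Finset.mem_inter] at hy
      obtain ⟨w, ⟨hw, _⟩, rfl⟩ := hy
      have := hf.2.2 w hw
      rw [mem_itv] at hy'
      omega)
    (by simp)
  have hDn : ∀ v ∈ D, v ∉ C := fun v h => Finset.disjoint_left.1 hDC h
  have hlow : ∀ v (h : v ∈ C), b ≤ (φ ⟨v, h⟩).1 ∧ (φ ⟨v, h⟩).1 < b + C.card + e := fun v h =>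
    (mem_itv _).1 (hφ2 ⟨v, h⟩).1
  refine ⟨fun v => if h : v ∈ C then φ ⟨v, h⟩ else f v, ⟨?_, ?_, ?_⟩, ?_⟩
  · intro u hu v hv huv
    rcases Finset.mem_union.1 hu with hu | hu <;> rcases Finset.mem_union.1 hv with hv | hv
    · simp only [hDn u hu, hDn v hv, dif_neg, not_false_eq_true] at huv
      exact hf.1 u hu v hv huv
    · simp only [hDn u hu, hv, dif_neg, dif_pos, not_false_eq_true] at huv
      have h1 := hlow v hv
      have h2 := hf.2.2 u hu
      rw [huv] at h2; omega
    · simp only [hDn v hv, hu, dif_neg, dif_pos, not_false_eq_true] at huv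
      have h1 := hlow u hu
      have h2 := hf.2.2 v hv
      rw [← huv] at h2; omega
    · simp only [hv, hu, dif_pos] at huv
      exact congrArg Subtype.val (hφ huv)
  · intro u hu v hv huv
    rcases Finset.mem_union.1 hu with hu | hu <;> rcases Finset.mem_union.1 hv with hv | hv
    · simp only [hDn u hu, hDn v hv, dif_neg, not_false_eq_true]
      exact hf.2.1 u hu v hv huv
    · simp only [hDn u hu, hv, dif_neg, dif_pos, not_false_eq_true]
      refine ((hφ2 ⟨v, hv⟩).2 _ (Finset.mem_image_of_mem f ?_)).symm
      exact Finset.mem_inter.2 ⟨hu, (mem_nb _ _ _).2 huv.symm⟩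
    · simp only [hDn v hv, hu, dif_neg, dif_pos, not_false_eq_true]
      refine ((hφ2 ⟨u, hu⟩).2 _ (Finset.mem_image_of_mem f ?_))
      exact Finset.mem_inter.2 ⟨hv, (mem_nb _ _ _).2 huv⟩
    · by_cases h : u = v
      · subst h; exact absurd huv (H.irrefl)
      · exact absurd huv (hC1 u hu v hv h)
  · intro v hv
    rcases Finset.mem_union.1 hv with hv | hv
    · simp only [hDn v hv, dif_neg, not_false_eq_true]
      have := hf.2.2 v hv
      omega
    · simp only [hv, dif_pos]
      exact (hlow v hv).2
  · intro v hv
    simp only [hDn v hv, dif_neg, not_false_eq_true]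

lemma class_iter {n Δ e : ℕ} {H G : SimpleGraph (Fin n)} (hA : PropA Δ e G)
    (hdeg : ∀ v, (nb H v).card ≤ Δ) (D Y : Finset (Fin n)) (b : ℕ) (f : Fin n → Fin n)
    (c : Fin n → ℕ)
    (hf : PEmb H G D b f) (hDY : Disjoint D Y)
    (hC1 : ∀ u v, c u = c v → u ≠ v → ¬ H.Adj u v)
    (hC2 : ∀ u v, c u = c v → u ≠ v → ∀ w, H.Adj u w → ¬ H.Adj v w)
    (M : ℕ) (hb : b + Y.card + M * e ≤ n) (j : ℕ) (hj : j ≤ M) :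
    ∃ f', PEmb H G (D ∪ Y.filter (fun v => c v < j))
      (b + (Y.filter (fun v => c v < j)).card + j * e) f' ∧ ∀ v ∈ D, f' v = f v := by
  classical
  induction j with
  | zero => exact ⟨f, by simpa using hf, fun _ _ => rfl⟩
  | succ j ih =>
    obtain ⟨f', hf', hff⟩ := ih (by omega)
    have hle : (j + 1) * e ≤ M * e := Nat.mul_le_mul_right _ hj
    rw [Nat.succ_mul] at hle ⊢
    have e1 : Y.filter (fun v => c v < j) ∪ Y.filter (fun v => c v = j)
        = Y.filter (fun v => c v < j + 1) := by
      ext v; simp only [Finset.mem_union, Finset.mem_filter]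
      constructor
      · rintro (⟨h, h'⟩ | ⟨h, h'⟩) <;> exact ⟨h, by omega⟩
      · rintro ⟨h, h'⟩
        rcases Nat.lt_succ_iff_lt_or_eq.1 h' with h' | h'
        · exact Or.inl ⟨h, h'⟩
        · exact Or.inr ⟨h, h'⟩
    have hdj : Disjoint (Y.filter (fun v => c v < j)) (Y.filter (fun v => c v = j)) := by
      rw [Finset.disjoint_left]
      intro v hv hv'
      rw [Finset.mem_filter] at hv hv'
      omega
    have e2 := Finset.card_union_of_disjoint hdj
    rw [e1] at e2
    have e3 : (Y.filter (fun v => c v < j + 1)).card ≤ Y.card := Finset.card_filter_le _ _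
    obtain ⟨f'', h1, h2⟩ := class_step hA hdeg _ (Y.filter (fun v => c v = j)) _ f' hf'
      (by
        rw [Finset.disjoint_union_left]
        exact ⟨hDY.mono_right (Finset.filter_subset _ _), hdj⟩)
      (fun u hu v hv => hC1 u v (by
        rw [(Finset.mem_filter.1 hu).2, (Finset.mem_filter.1 hv).2]))
      (fun u hu v hv => hC2 u v (by
        rw [(Finset.mem_filter.1 hu).2, (Finset.mem_filter.1 hv).2]))
      (by omega)
    rw [Finset.union_assoc, e1] at h1
    have e4 : b + (Y.filter (fun v => c v < j)).card + j * e + (Y.filter (fun v => c v = j)).card + e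
      = b + (Y.filter (fun v => c v < j + 1)).card + (j * e + e) := by omega
    rw [e4] at h1
    refine ⟨f'', h1, fun v hv => ?_⟩
    rw [h2 v (Finset.mem_union_left _ hv), hff v hv]

lemma greedy_color {V : Type*} [Fintype V] [DecidableEq V] (R : V → V → Prop) [DecidableRel R]
    (hs : ∀ u v, R u v → R v u) (K : ℕ) (hK : ∀ u, (Finset.univ.filter (R u)).card ≤ K) :
    ∃ c : V → ℕ, (∀ v, c v < K + 1) ∧ ∀ u v, u ≠ v → R u v → c u ≠ c v := by
  suffices h : ∀ s : Finset V, ∃ c : V → ℕ, (∀ v, c v < K + 1) ∧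
      ∀ u ∈ s, ∀ v ∈ s, u ≠ v → R u v → c u ≠ c v by
    obtain ⟨c, h1, h2⟩ := h Finset.univ
    exact ⟨c, h1, fun u v => h2 u (Finset.mem_univ _) v (Finset.mem_univ _)⟩
  intro s
  induction s using Finset.induction_on with
  | empty => exact ⟨fun _ => 0, by simp, by simp⟩
  | insert a s ha ih =>
    obtain ⟨c, h1, h2⟩ := ih
    obtain ⟨x, hx, hx'⟩ := Finset.exists_mem_notMem_of_card_lt_card
      (s := (Finset.univ.filter (R a)).image c) (t := Finset.range (K + 1))
      (by
        rw [Finset.card_range]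
        exact Nat.lt_succ_of_le (Finset.card_image_le.trans (hK a)))
    have hne : ∀ v, R a v → x ≠ c v := by
      rintro v hv rfl
      exact hx' (Finset.mem_image_of_mem c (by simpa using hv))
    refine ⟨Function.update c a x, ?_, ?_⟩
    · intro v
      by_cases h : v = a
      · subst h; simpa using hx
      · simpa [h] using h1 v
    · intro u hu v hv huv hR
      rcases Finset.mem_insert.1 hu with rfl | hu' <;> rcases Finset.mem_insert.1 hv with rfl | hv'
      · exact absurd rfl huv
      · simpa [huv.symm] using hne v hR
      · simpa [huv] using (hne u (hs _ _ hR)).symm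
      · have hu1 : u ≠ a := fun h => ha (h ▸ hu')
        have hv1 : v ≠ a := fun h => ha (h ▸ hv')
        simpa [hu1, hv1] using h2 u hu' v hv' huv hR

lemma dist_color {n Δ : ℕ} (H : SimpleGraph (Fin n)) (hdeg : ∀ v, (nb H v).card ≤ Δ) :
    ∃ c : Fin n → ℕ, (∀ v, c v < Δ + Δ * Δ + Δ * Δ * Δ + 1) ∧
      (∀ u v, c u = c v → u ≠ v → ¬ H.Adj u v) ∧
      (∀ u v, c u = c v → u ≠ v → ∀ w, H.Adj u w → ¬ H.Adj v w) ∧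
      (∀ u v, c u = c v → u ≠ v → ∀ w z, H.Adj u w → H.Adj w z → ¬ H.Adj v z) := by
  classical
  obtain ⟨c, h1, h2⟩ := greedy_color (fun u v => H.Adj u v ∨ (∃ w, H.Adj u w ∧ H.Adj v w) ∨
      ∃ w z, H.Adj u w ∧ H.Adj w z ∧ H.Adj v z) (by
      rintro u v (h | ⟨w, h, h'⟩ | ⟨w, z, h, h', h''⟩)
      · exact Or.inl h.symm
      · exact Or.inr (Or.inl ⟨w, h', h⟩)
      · exact Or.inr (Or.inr ⟨z, w, h'', h'.symm, h⟩)) (Δ + Δ * Δ + Δ * Δ * Δ) (by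
      intro u
      have b1 : ((nb H u).biUnion (nb H)).card ≤ Δ * Δ :=
        (Finset.card_biUnion_le_card_mul _ _ Δ fun v _ => hdeg v).trans
          (Nat.mul_le_mul_right _ (hdeg u))
      have b2 : (((nb H u).biUnion (nb H)).biUnion (nb H)).card ≤ Δ * Δ * Δ :=
        (Finset.card_biUnion_le_card_mul _ _ Δ fun v _ => hdeg v).trans
          (Nat.mul_le_mul_right _ b1)
      refine (Finset.card_le_card (t := nb H u ∪ (nb H u).biUnion (nb H) ∪
        ((nb H u).biUnion (nb H)).biUnion (nb H)) ?_).trans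
        ((Finset.card_union_le _ _).trans (Nat.add_le_add ((Finset.card_union_le _ _).trans
          (Nat.add_le_add (hdeg u) b1)) b2))
      intro v hv
      simp only [Finset.mem_filter, Finset.mem_univ, true_and] at hv
      simp only [Finset.mem_union, Finset.mem_biUnion, mem_nb]
      rcases hv with h | ⟨w, h, h'⟩ | ⟨w, z, h, h', h''⟩
      · exact Or.inl (Or.inl h)
      · exact Or.inl (Or.inr ⟨w, h, h'.symm⟩)
      · exact Or.inr ⟨z, ⟨w, h, h'⟩, h''.symm⟩)
  refine ⟨c, h1, ?_, ?_, ?_⟩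
  · intro u v hc hne h; exact h2 u v hne (Or.inl h) hc
  · intro u v hc hne w h h'; exact h2 u v hne (Or.inr (Or.inl ⟨w, h, h'⟩)) hc
  · intro u v hc hne w z h h' h''; exact h2 u v hne (Or.inr (Or.inr ⟨w, z, h, h', h''⟩)) hc
theorem det_embed {n Δ e N m : ℕ} {H G : SimpleGraph (Fin n)} (hA : PropA Δ e G)
    (hT : ∀ d ≤ Δ, ∃ T : Fin N ⊕ Fin N → Finset (Fin n),
      (∀ i, T i ⊆ itv n 0 (2 * (d * (N + e)))) ∧ (∀ i, (T i).card = d) ∧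
      (∀ i j, i ≠ j → Disjoint (T i) (T j)) ∧
      (∀ i, ∀ u ∈ T i, ∀ v ∈ T i, u ≠ v → G.Adj u v) ∧
      ∀ S : Finset (Fin n), S.card ≤ m → S.card ≤ (dhits G S T).card)
    (M : ℕ) (hM : M = Δ + Δ * Δ + Δ * Δ * Δ + 1)
    (hN : M * (Δ + 1) * (2 * N) ≤ n) (he1 : (2 * Δ + M + 1) * e ≤ m)
    (he2 : (2 * Δ + M) * e ≤ 2 * N)
    (hdeg : ∀ v, (nb H v).card ≤ Δ) : ContainsCopy H G := by
  classical
  obtain ⟨c, hc0, hc1, hc2, hc3⟩ := dist_color H hdeg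
  rw [← hM] at hc0
  -- popular class
  obtain ⟨⟨c0, d⟩, hcd, hX0⟩ := Finset.exists_le_card_fiber_of_mul_le_card_of_maps_to
    (s := (Finset.univ : Finset (Fin n))) (t := Finset.range M ×ˢ Finset.range (Δ + 1))
    (f := fun v => (c v, (nb H v).card)) (n := 2 * N)
    (fun v _ => by
      simp only [Finset.mem_product, Finset.mem_range]
      exact ⟨hc0 v, Nat.lt_succ_of_le (hdeg v)⟩)
    ⟨(0, 0), by simp [hM]⟩ (by simpa using hN)
  have hd : d ≤ Δ := by
    simp only [Finset.mem_product, Finset.mem_range] at hcd; omega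
  set X0 : Finset (Fin n) := Finset.univ.filter fun v => (c v, (nb H v).card) = (c0, d) with hX0d
  obtain ⟨x'⟩ : Nonempty (Fin N ⊕ Fin N ↪ X0) := Function.Embedding.nonempty_of_card_le (by
    simp only [Fintype.card_sum, Fintype.card_fin, Fintype.card_coe]; omega)
  set x : Fin N ⊕ Fin N → Fin n := fun i => (x' i).1 with hx
  have hxi : ∀ i j, x i = x j → i = j := fun i j h => x'.injective (Subtype.ext h)
  have hxp : ∀ i, c (x i) = c0 ∧ (nb H (x i)).card = d := by
    intro i
    have := (Finset.mem_filter.1 (x' i).2).2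
    simpa [Prod.ext_iff] using this
  have hcx : ∀ i j, c (x i) = c (x j) := fun i j => (hxp i).1.trans (hxp j).1.symm
  obtain ⟨T, hT1, hT2, hT3, hT4, hT5⟩ := hT d hd
  clear_value x
  clear hX0 hx hT
  -- disjointness of neighbourhoods
  have huniq : ∀ i j v, H.Adj (x i) v → H.Adj (x j) v → i = j := by
    intro i j v h h'
    by_contra hne
    exact hc2 _ _ (hcx i j) (fun h => hne (hxi _ _ h)) v h h'
  have hXind : ∀ i j, ¬ H.Adj (x i) (x j) := by
    intro i j h
    by_cases hne : i = j
    · subst hne; exact H.irrefl h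
    · exact hc1 _ _ (hcx i j) (fun h => hne (hxi _ _ h)) h
  -- initial embedding
  have g : ∀ i, nb H (x i) ≃ T i := fun i => Finset.equivOfCardEq ((hxp i).2.trans (hT2 i).symm)
  set f0 : Fin n → Fin n := fun v => if h : ∃ i, v ∈ nb H (x i) then
    (g h.choose ⟨v, h.choose_spec⟩).1 else v with hf0
  have hf0g : ∀ i v (h : v ∈ nb H (x i)), f0 v = (g i ⟨v, h⟩).1 := by
    intro i v h
    have hex : ∃ i, v ∈ nb H (x i) := ⟨i, h⟩
    have h2 : hex.choose = i := huniq _ _ v ((mem_nb _ _ _).1 hex.choose_spec) ((mem_nb _ _ _).1 h)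
    simp only [hf0, dif_pos hex]
    have : ∀ j (hj : v ∈ nb H (x j)), j = i → (g j ⟨v, hj⟩).1 = (g i ⟨v, h⟩).1 := by
      rintro j hj rfl; rfl
    exact this _ _ h2
  have hf0T : ∀ i v, H.Adj (x i) v → f0 v ∈ T i := by
    intro i v h
    rw [hf0g i v ((mem_nb _ _ _).2 h)]; exact Subtype.prop _
  have hf0inj : ∀ i u v, H.Adj (x i) u → H.Adj (x i) v → f0 u = f0 v → u = v := by
    intro i u v hu hv h
    rw [hf0g i u ((mem_nb _ _ _).2 hu), hf0g i v ((mem_nb _ _ _).2 hv)] at h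
    exact congrArg Subtype.val ((g i).injective (Subtype.ext h))
  clear_value f0
  clear hf0g hf0 g
  set D : Finset (Fin n) := Finset.univ.biUnion fun i => nb H (x i) with hD
  have hmD : ∀ v, v ∈ D ↔ ∃ i, H.Adj (x i) v := by
    intro v; simp [hD, mem_nb]
  have hDcard : D.card = 2 * N * d := by
    rw [hD, Finset.card_biUnion]
    · simp only [(hxp _).2, Finset.sum_const, Finset.card_univ, Fintype.card_sum, Fintype.card_fin,
        smul_eq_mul]
      ring
    · intro i _ j _ hij
      simp only [Function.onFun]
      rw [Finset.disjoint_left]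
      intro v hv hv'
      exact hij (huniq i j v ((mem_nb _ _ _).1 hv) ((mem_nb _ _ _).1 hv'))
  set X : Finset (Fin n) := Finset.univ.image x with hX
  have hmX : ∀ v, v ∈ X ↔ ∃ i, x i = v := by intro v; simp [hX]
  have hXcard : X.card = 2 * N := by
    rw [hX, Finset.card_image_of_injective _ (fun i j h => hxi i j h)]
    simp only [Finset.card_univ, Fintype.card_sum, Fintype.card_fin]; ring
  have hDX : Disjoint D X := by
    rw [Finset.disjoint_left]
    intro v hv hv'
    obtain ⟨i, hi⟩ := (hmD v).1 hv
    obtain ⟨j, rfl⟩ := (hmX v).1 hv'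
    exact hXind i j hi
  set Y : Finset (Fin n) := (D ∪ X)ᶜ with hY
  have hYcard : Y.card + (2 * N * d + 2 * N) = n := by
    have := Finset.card_compl_add_card (D ∪ X)
    rw [Finset.card_union_of_disjoint hDX, hDcard, hXcard, Fintype.card_fin] at this
    exact this
  have hemb0 : PEmb H G D (2 * (d * (N + e))) f0 := by
    refine ⟨?_, ?_, ?_⟩
    · intro u hu v hv huv
      obtain ⟨i, hi⟩ := (hmD u).1 hu
      obtain ⟨j, hj⟩ := (hmD v).1 hv
      by_cases hij : i = j
      · subst hij; exact hf0inj i u v hi hj huv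
      · exfalso
        have h1 := hf0T i u hi
        rw [huv] at h1
        exact Finset.disjoint_left.1 (hT3 i j hij) h1 (hf0T j v hj)
    · intro u hu v hv huv
      obtain ⟨i, hi⟩ := (hmD u).1 hu
      obtain ⟨j, hj⟩ := (hmD v).1 hv
      by_cases hij : i = j
      · subst hij
        refine hT4 i _ (hf0T i u hi) _ (hf0T i v hj) fun h => ?_
        exact huv.ne (hf0inj i u v hi hj h)
      · exact absurd hj (hc3 _ _ (hcx i j) (fun h => hij (hxi _ _ h)) u v hi huv)
    · intro v hv
      obtain ⟨i, hi⟩ := (hmD v).1 hv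
      exact ((mem_itv _).1 (hT1 i (hf0T i v hi))).2
  have hde : 2 * (d * (N + e)) = 2 * N * d + 2 * d * e := by ring
  have hdle : 2 * d * e ≤ 2 * Δ * e := Nat.mul_le_mul_right _ (by omega)
  have he1' : 2 * Δ * e + M * e + e ≤ m := by
    calc _ = (2 * Δ + M + 1) * e := by ring
      _ ≤ m := he1
  have he2' : 2 * Δ * e + M * e ≤ 2 * N := by
    calc _ = (2 * Δ + M) * e := by ring
      _ ≤ _ := he2
  obtain ⟨f, hf, hff⟩ := class_iter hA hdeg D Y _ f0 c hemb0
    (by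
      rw [hY, Finset.disjoint_left]
      intro v hv hv'
      exact Finset.mem_compl.1 hv' (Finset.mem_union_left _ hv))
    hc1 hc2 M (by rw [hde]; omega) M le_rfl
  have hYf : Y.filter (fun v => c v < M) = Y := Finset.filter_true_of_mem fun v _ => hc0 v
  rw [hYf] at hf
  have hDY : D ∪ Y = Xᶜ := by
    ext v
    simp only [hY, Finset.mem_union, Finset.mem_compl, not_or]
    constructor
    · rintro (h | h)
      · exact Finset.disjoint_left.1 hDX h
      · exact h.2
    · intro h
      by_cases h' : v ∈ D
      · exact Or.inl h'
      · exact Or.inr ⟨h', h⟩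
  rw [hDY] at hf
  set b := 2 * (d * (N + e)) + Y.card + M * e with hb
  have hbn : b + 2 * N = n + 2 * d * e + M * e := by rw [hb, hde]; omega
  obtain ⟨hf1, hf2, hf3⟩ := hf
  set L : Finset (Fin n) := (Xᶜ.image f)ᶜ with hL
  have hLcard : L.card = 2 * N := by
    have h1 : L.card + (Xᶜ.image f).card = _ := Finset.card_compl_add_card (Xᶜ.image f)
    rw [Finset.card_image_of_injOn (fun u hu v hv h => hf1 u hu v hv h), Fintype.card_fin] at h1
    have h2 := Finset.card_compl_add_card X
    rw [Fintype.card_fin, hXcard] at h2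
    omega
  have hVL : itv n b n ⊆ L := by
    intro w hw
    rw [hL, Finset.mem_compl]
    intro h
    obtain ⟨v, hv, rfl⟩ := Finset.mem_image.1 h
    have := hf3 v hv
    have := ((mem_itv _).1 hw).1
    omega
  have hbn' : b ≤ n := by omega
  obtain ⟨ψ, hψ, hψ2⟩ := hall_gen G L T (by
    intro A
    have hAc : A.card ≤ 2 * N := (Finset.card_le_univ A).trans (by
      simp only [Fintype.card_sum, Fintype.card_fin]; omega)
    have hsub : hits G (itv n b n) A T ⊆ hits G L A T := by
      intro w hw
      obtain ⟨h1, h2⟩ := (mem_hits _ _ _ _ _).1 hw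
      exact (mem_hits _ _ _ _ _).2 ⟨hVL h1, h2⟩
    have hsubc := Finset.card_le_card hsub
    rcases propA_gen hA hbn' le_rfl A (by omega) T (fun i _ => (hT2 i).trans_le hd)
      (fun i _ j _ => hT3 i j) (by
        intro i _
        rw [Finset.disjoint_left]
        intro v hv hv'
        have h1 := ((mem_itv _).1 (hT1 i hv)).2
        have h2 := ((mem_itv _).1 hv').1
        omega) with h | h
    · exact h.trans hsubc
    · rw [itv_card le_rfl] at h
      set S := L \ hits G L A T with hS
      have hScard : S.card + (hits G L A T).card = 2 * N := by
        rw [hS, Finset.card_sdiff_add_card_eq_card (hits_subset _ _ _ _), hLcard]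
      have h5 := hT5 S (by omega)
      have h6 : dhits G S T ⊆ Aᶜ := by
        intro i hi
        rw [Finset.mem_compl]
        intro hiA
        obtain ⟨w, hw, hw'⟩ := (mem_dhits _ _ _ _).1 hi
        rw [hS, Finset.mem_sdiff] at hw
        exact hw.2 ((mem_hits _ _ _ _ _).2 ⟨hw.1, i, hiA, hw'⟩)
      have h7 := Finset.card_le_card h6
      rw [Finset.card_compl] at h7
      simp only [Fintype.card_sum, Fintype.card_fin] at h7
      omega)
  have hψL : ∀ i u, u ∉ X → f u ≠ ψ i := by
    intro i u hu h
    have := (hψ2 i).1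
    rw [hL, Finset.mem_compl, ← h] at this
    exact this (Finset.mem_image_of_mem f (Finset.mem_compl.2 hu))
  have hadj : ∀ i v, H.Adj (x i) v → G.Adj (ψ i) (f v) := by
    intro i v h
    rw [hff v ((hmD v).2 ⟨i, h⟩)]
    exact (hψ2 i).2 _ (hf0T i v h)
  have hadjX : ∀ i v, H.Adj (x i) v → v ∉ X := by
    intro i v h h'
    obtain ⟨j, rfl⟩ := (hmX v).1 h'
    exact hXind i j h
  -- final map
  have hfin : ∃ F : Fin n → Fin n, (∀ i, F (x i) = ψ i) ∧ ∀ v, v ∉ X → F v = f v := by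
    refine ⟨fun v => if h : ∃ i, x i = v then ψ h.choose else f v, ?_, ?_⟩
    · intro i
      have hex : ∃ j, x j = x i := ⟨i, rfl⟩
      simp only [dif_pos hex]
      rw [hxi _ _ hex.choose_spec]
    · intro v hv
      rw [hmX] at hv
      simp only [dif_neg hv]
  obtain ⟨F, hF1, hF2⟩ := hfin
  refine ⟨F, ?_, ?_⟩
  · intro u v huv
    by_cases hu : u ∈ X <;> by_cases hv : v ∈ X
    · obtain ⟨i, rfl⟩ := (hmX u).1 hu
      obtain ⟨j, rfl⟩ := (hmX v).1 hv
      rw [hF1, hF1] at huv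
      rw [hψ huv]
    · obtain ⟨i, rfl⟩ := (hmX u).1 hu
      rw [hF1, hF2 v hv] at huv
      exact absurd huv.symm (hψL i v hv)
    · obtain ⟨j, rfl⟩ := (hmX v).1 hv
      rw [hF1, hF2 u hu] at huv
      exact absurd huv (hψL j u hu)
    · rw [hF2 u hu, hF2 v hv] at huv
      exact hf1 u (Finset.mem_compl.2 hu) v (Finset.mem_compl.2 hv) huv
  · intro u v huv
    by_cases hu : u ∈ X
    · obtain ⟨i, rfl⟩ := (hmX u).1 hu
      rw [hF1, hF2 v (hadjX i v huv)]
      exact hadj i v huv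
    · by_cases hv : v ∈ X
      · obtain ⟨j, rfl⟩ := (hmX v).1 hv
        rw [hF1, hF2 u hu]
        exact (hadj j u huv.symm).symm
      · rw [hF2 u hu, hF2 v hv]
        exact hf2 u (Finset.mem_compl.2 hu) v (Finset.mem_compl.2 hv) huv

lemma propB_sum {n N m : ℕ} (G : SimpleGraph (Fin n)) (I₀ I₁ : Finset (Fin n))
    (hI : Disjoint I₀ I₁) (T₀ T₁ : Fin N → Finset (Fin n)) (h₀ : PropB m I₀ T₀ G)
    (h₁ : PropB m I₁ T₁ G) (S : Finset (Fin n)) (hS : S.card ≤ m) :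
    S.card ≤ (dhits G S (Sum.elim T₀ T₁)).card := by
  classical
  have a0 := h₀ (S \ I₀) Finset.sdiff_disjoint
    ((Finset.card_le_card Finset.sdiff_subset).trans hS)
  have a1 := h₁ (S ∩ I₀) (hI.mono_left Finset.inter_subset_right)
    ((Finset.card_le_card Finset.inter_subset_left).trans hS)
  have a2 := Finset.card_sdiff_add_card_inter S I₀
  have a3 : (dhits G (S \ I₀) T₀).disjSum (dhits G (S ∩ I₀) T₁) ⊆ dhits G S (Sum.elim T₀ T₁) := by
    intro i hi
    rw [Finset.mem_disjSum] at hi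
    rw [mem_dhits]
    rcases hi with ⟨j, hj, rfl⟩ | ⟨j, hj, rfl⟩
    · obtain ⟨w, hw, h⟩ := (mem_dhits _ _ _ _).1 hj
      exact ⟨w, (Finset.mem_sdiff.1 hw).1, h⟩
    · obtain ⟨w, hw, h⟩ := (mem_dhits _ _ _ _).1 hj
      exact ⟨w, (Finset.mem_inter.1 hw).1, h⟩
  have a4 := Finset.card_le_card a3
  rw [Finset.card_disjSum] at a4
  omega

lemma nb_card_of_maxDeg {n Δ : ℕ} {H : SimpleGraph (Fin n)} (h : maxDeg H ≤ Δ) (v : Fin n) :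
    (nb H v).card ≤ Δ := by
  have h1 : (H.neighborSet v).ncard ≤ maxDeg H :=
    Finset.le_sup (f := fun v => (H.neighborSet v).ncard) (Finset.mem_univ v)
  have h2 : H.neighborSet v = (nb H v : Set (Fin n)) := by
    ext w; simp [mem_nb]
  rw [h2, Set.ncard_coe_finset] at h1
  exact h1.trans h

/-- the `β`-th reserved interval -/
def resI (n d L : ℕ) (β : Bool) : Finset (Fin n) :=
  itv n (bif β then d * L else 0) ((bif β then d * L else 0) + d * L)

lemma prob_main {n : ℕ} {p : ℝ} (h0 : 0 ≤ p) (h1 : p ≤ 1) (Δ M Q : ℕ) (hΔ : 1 ≤ Δ)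
    (hM : M = Δ + Δ * Δ + Δ * Δ * Δ + 1) (hQ : Q = 2 * (M * (Δ + 1)) * (2 * Δ + M + 2))
    (he : Real.exp (-(p ^ Δ)) ^ (n / Q) * ((n : ℝ) + 1) ^ (Δ + 1 + 4) ≤ 1) :
    (gnp n p).real
      {ω | ∀ H : SimpleGraph (Fin n), maxDeg H ≤ Δ → ContainsCopy H (graphOf ω)}ᶜ
      ≤ (1 + 2 * ((Δ : ℝ) + 1)) * ((n : ℝ) + 1)⁻¹ := by
  set N := n / (2 * (M * (Δ + 1))) with hN
  set e := n / Q with hedef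
  set m := (2 * Δ + M + 1) * e with hm
  have heN : e = N / (2 * Δ + M + 2) := by rw [hedef, hQ, hN, Nat.div_div_eq_div_mul]
  have hme : m + e ≤ N := by
    calc m + e = e * (2 * Δ + M + 2) := by rw [hm]; ring
      _ ≤ N := by rw [heN]; exact Nat.div_mul_le_self _ _
  have hNn : N * (2 * (M * (Δ + 1))) ≤ n := Nat.div_mul_le_self _ _
  have hNn' : N ≤ n := Nat.div_le_self _ _
  have hmN : m ≤ N := (Nat.le_add_right m e).trans hme
  have hroom : ∀ d ≤ Δ, 2 * (d * (N + e)) ≤ n := by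
    intro d hd
    have h3 : d * (N + e) ≤ (Δ + 1) * (N + N) := Nat.mul_le_mul (by omega) (by omega)
    have h4 : 2 * ((Δ + 1) * (N + N)) ≤ N * (2 * (M * (Δ + 1))) := by
      have : 2 ≤ M := by rw [hM]; nlinarith
      calc 2 * ((Δ + 1) * (N + N)) = N * (2 * (2 * (Δ + 1))) := by ring
        _ ≤ _ := by gcongr
    omega
  set B : Fin (Δ + 1) × Bool → Set (Sym2 (Fin n) → Bool) := fun x =>
    {ω | ¬ PropB m (resI n x.1 (N + e) x.2)
      (selFam (CliqueFam N x.1 (resI n x.1 (N + e) x.2) (graphOf ω)) fun _ => ∅) (graphOf ω)}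
    with hB
  have hBp := union_bound (n := n) (p := p) B _ fun x =>
    prob_sel h0 h1 Δ e N m x.1 hΔ he hNn' hme (by first | exact hmN.trans hNn' | exact Nat.lt_succ_iff.1 x.1.2) (by first | exact hmN.trans hNn' | exact Nat.lt_succ_iff.1 x.1.2) (resI n x.1 (N + e) x.2)
  have hAp := prob_A h0 h1 Δ e he
  have hsub : {ω | ∀ H : SimpleGraph (Fin n), maxDeg H ≤ Δ → ContainsCopy H (graphOf ω)}ᶜ ⊆
      {ω | ¬ PropA Δ e (graphOf ω)} ∪ {ω | ∃ x, ω ∈ B x} := by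
    intro ω hω
    by_contra hcon
    simp only [Set.mem_union, Set.mem_ofPred_eq, not_or, not_not, not_exists, hB] at hcon
    obtain ⟨hA, hBB⟩ := hcon
    refine hω fun H hH => ?_
    refine det_embed (N := N) (m := m) hA ?_ M hM ?_ le_rfl ?_ (nb_card_of_maxDeg hH)
    · intro d hd
      have hr := hroom d hd
      have hcl : ∀ β, CliqueFam N d (resI n d (N + e) β) (graphOf ω)
          (selFam (CliqueFam N d (resI n d (N + e) β) (graphOf ω)) fun _ => ∅) := by
        intro β
        have hex : ∃ T, CliqueFam N d (resI n d (N + e) β) (graphOf ω) T :=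
          exists_cliques hA _ d hd (by cases β <;> simp only [cond_true, cond_false] <;> omega)
        rw [selFam, dif_pos hex]
        exact hex.choose_spec
      have hdisj : Disjoint (resI n d (N + e) false) (resI n d (N + e) true) := by
        rw [Finset.disjoint_left]
        intro v hv hv'
        simp only [resI, mem_itv, cond_true, cond_false] at hv hv'
        omega
      have hb0 := hBB (⟨d, by omega⟩, false)
      have hb1 := hBB (⟨d, by omega⟩, true)
      simp only at hb0 hb1
      have c0 := hcl false
      have c1 := hcl true
      refine ⟨Sum.elim _ _, ?_, ?_, ?_, ?_, fun S hS => propB_sum _ _ _ hdisj _ _ hb0 hb1 S hS⟩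
      · rintro (i | i) v hv
        · have := c0.1 i hv
          simp only [resI, mem_itv, cond_false] at this ⊢; omega
        · have := c1.1 i hv
          simp only [resI, mem_itv, cond_true] at this ⊢; omega
      · rintro (i | i)
        · exact c0.2.1 i
        · exact c1.2.1 i
      · rintro (i | i) (j | j) hij
        · exact c0.2.2.1 i j fun h => hij (by rw [h])
        · exact hdisj.mono (c0.1 i) (c1.1 j)
        · exact (hdisj.mono (c0.1 j) (c1.1 i)).symm
        · exact c1.2.2.1 i j fun h => hij (by rw [h])
      · rintro (i | i)
        · exact c0.2.2.2 i
        · exact c1.2.2.2 i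
    · calc _ = N * (2 * (M * (Δ + 1))) := by ring
        _ ≤ n := hNn
    · have : (2 * Δ + M) * e ≤ m := Nat.mul_le_mul_right _ (by omega)
      exact this.trans (hmN.trans (Nat.le_mul_of_pos_left N (by norm_num)))
  refine (measureReal_mono hsub).trans ((measureReal_union_le _ _).trans ?_)
  refine (add_le_add hAp hBp).trans (le_of_eq ?_)
  simp only [Fintype.card_prod, Fintype.card_fin, Fintype.card_bool]
  push_cast
  ring

lemma num_aux (Δ Q n : ℕ) (hQ : 0 < Q) (hn : 2 * Q ≤ n) (hn2 : 2 ≤ n) (q : ℝ)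
    (hq : 4 * Q * ((Δ : ℝ) + 5) * (Real.log n / n) ≤ q) :
    Real.exp (-q) ^ (n / Q) * ((n : ℝ) + 1) ^ (Δ + 1 + 4) ≤ 1 := by
  have hn0 : (0 : ℝ) < n := by exact_mod_cast (by omega : 0 < n)
  have hQ0 : (0 : ℝ) < Q := by exact_mod_cast hQ
  have hlog : 0 ≤ Real.log n := Real.log_natCast_nonneg n
  have he : (n : ℝ) ≤ 2 * Q * ((n / Q : ℕ) : ℝ) := by
    have h1 : n / Q * Q + n % Q = n := Nat.div_add_mod' n Q
    have h2 := Nat.mod_lt n hQ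
    have : n ≤ 2 * Q * (n / Q) := by
      have : 2 * Q * (n / Q) = 2 * (n / Q * Q) := by ring
      omega
    exact_mod_cast this
  have hl2 : Real.log ((n : ℝ) + 1) ≤ 2 * Real.log n := by
    rw [← Real.log_rpow hn0]
    apply Real.log_le_log (by positivity)
    have : (2 : ℝ) ≤ n := by exact_mod_cast hn2
    norm_num
    nlinarith
  have hqe : ((Δ : ℝ) + 5) * (2 * Real.log n) ≤ q * ((n / Q : ℕ) : ℝ) := by
    calc ((Δ : ℝ) + 5) * (2 * Real.log n)
        = (4 * Q * ((Δ : ℝ) + 5) * (Real.log n / n)) * (n / (2 * Q)) := by field_simp; ring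
      _ ≤ (4 * Q * ((Δ : ℝ) + 5) * (Real.log n / n)) * ((n / Q : ℕ) : ℝ) := by
          apply mul_le_mul_of_nonneg_left _ (by positivity)
          rw [div_le_iff₀ (by positivity)]; linarith
      _ ≤ _ := mul_le_mul_of_nonneg_right hq (Nat.cast_nonneg _)
  have hpos : (0 : ℝ) < (n : ℝ) + 1 := by positivity
  rw [← Real.exp_nat_mul, ← Real.exp_log hpos, ← Real.exp_nat_mul, ← Real.exp_add,
    Real.exp_le_one_iff]
  push_cast
  have : ((Δ : ℝ) + 5) * Real.log ((n : ℝ) + 1) ≤ ((Δ : ℝ) + 5) * (2 * Real.log n) :=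
    mul_le_mul_of_nonneg_left hl2 (by positivity)
  nlinarith

/-- **Dellamonica–Kohayakawa–Rödl–Ruciński theorem.** For each `Δ ≥ 3` there is a constant `C`
such that if `p ≥ C·(log n/n)^{1/Δ}` then a.a.s. `G(n,p)` is universal for `𝓗(n,Δ)`, the family
of all `n`-vertex graphs with maximum degree at most `Δ`. -/
theorem stmt_12 (Δ : ℕ) (hΔ : 3 ≤ Δ) :
    ∃ C : ℝ, 0 < C ∧ ∀ p : ℕ → ℝ, (∀ n, 0 ≤ p n ∧ p n ≤ 1) →
      (∀ᶠ n : ℕ in atTop, C * (Real.log n / n) ^ ((1 : ℝ) / Δ) ≤ p n) →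
      Tendsto (fun n : ℕ => gnp n (p n)
        {ω | ∀ H : SimpleGraph (Fin n), maxDeg H ≤ Δ → ContainsCopy H (graphOf ω)})
        atTop (𝓝 1) := by
  set M := Δ + Δ * Δ + Δ * Δ * Δ + 1 with hM
  set Q := 2 * (M * (Δ + 1)) * (2 * Δ + M + 2) with hQ
  have hQ0 : 0 < Q := by positivity
  have hΔ0 : (Δ : ℝ) ≠ 0 := by exact_mod_cast (by omega : Δ ≠ 0)
  set K : ℝ := 4 * Q * ((Δ : ℝ) + 5) with hK
  have hK0 : 0 < K := by
    have : (0 : ℝ) < Q := by exact_mod_cast hQ0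
    positivity
  refine ⟨K ^ ((1 : ℝ) / Δ), Real.rpow_pos_of_pos hK0 _, fun p hp hev => ?_⟩
  have hbad : ∀ᶠ n : ℕ in atTop, (gnp n (p n)).real
      {ω | ∀ H : SimpleGraph (Fin n), maxDeg H ≤ Δ → ContainsCopy H (graphOf ω)}ᶜ
      ≤ (1 + 2 * ((Δ : ℝ) + 1)) * ((n : ℝ) + 1)⁻¹ := by
    filter_upwards [hev, eventually_ge_atTop (2 * Q), eventually_ge_atTop 2] with n h1 h2 h3
    refine prob_main (hp n).1 (hp n).2 Δ M Q (by omega) hM hQ ?_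
    refine num_aux Δ Q n hQ0 h2 h3 _ ?_
    have hl : 0 ≤ Real.log n / n := div_nonneg (Real.log_natCast_nonneg n) (Nat.cast_nonneg n)
    rw [← Real.mul_rpow hK0.le hl] at h1
    have h4 := pow_le_pow_left₀ (by positivity) h1 Δ
    rw [← Real.rpow_natCast, ← Real.rpow_mul (by positivity), one_div, inv_mul_cancel₀ hΔ0,
      Real.rpow_one] at h4
    exact h4
  have hlim : Tendsto (fun n : ℕ => (1 + 2 * ((Δ : ℝ) + 1)) * ((n : ℝ) + 1)⁻¹) atTop (𝓝 0) := by
    have := (tendsto_one_div_add_atTop_nhds_zero_nat (𝕜 := ℝ)).const_mul (1 + 2 * ((Δ : ℝ) + 1))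
    simpa using this
  have hz : Tendsto (fun n : ℕ => (gnp n (p n)).real
      {ω | ∀ H : SimpleGraph (Fin n), maxDeg H ≤ Δ → ContainsCopy H (graphOf ω)}ᶜ) atTop (𝓝 0) :=
    squeeze_zero' (Eventually.of_forall fun _ => measureReal_nonneg) hbad hlim
  have h1 : Tendsto (fun n : ℕ => (gnp n (p n)).real
      {ω | ∀ H : SimpleGraph (Fin n), maxDeg H ≤ Δ → ContainsCopy H (graphOf ω)}) atTop (𝓝 1) := by
    have := hz.const_sub 1
    simp only [probReal_compl_eq_one_sub (om_meas _), sub_sub_cancel, sub_zero] at this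
    exact this
  have h2 := ENNReal.tendsto_ofReal h1
  rw [ENNReal.ofReal_one] at h2
  exact h2.congr fun n => ofReal_measureReal (measure_ne_top _ _)
end
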